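/- arXiv:1307.8442 — 5 statements merged into one kernel-verified Lean document; each statement's English description precedes it below -/
import Mathlib

section
/- Let 𝒢 = (φ_j : G → G_j : 1 ≤ j ≤ m) be a finite Abelian group HBL datum (i.e., G and all G_j are finite) and let s ∈ [0,1]^m. Then 𝔹(𝒢,s) = 𝔸(𝒢,s); that is, the optimal constant in the inequality ∑_{x∈G} ∏_{j=1}^m f_j(φ_j(x)) ≤ C · ∏_{j=1}^m ‖f_j‖_{1/s_j} over all nonnegative functions f_j on G_j equals sup{ A(H,s) : H a finite subgroup of G }. -/
open scoped ENNReal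

/-- The `L^{1/s}` norm with respect to counting measure; for `s = 0` this is the sup norm
`‖f‖_∞`, and for `s ≠ 0` it is `(∑_y f(y)^{1/s})^s`. -/
noncomputable def HBLnorm {α : Type*} (s : ℝ) (f : α → ℝ≥0∞) : ℝ≥0∞ :=
  if s = 0 then ⨆ y, f y else (∑' y, f y ^ (1 / s)) ^ s

/-- The optimal constant `𝔹(𝒢,s)`: the smallest `C ∈ [0,∞]` such that
`∑_{x ∈ G} ∏_j f_j(φ_j x) ≤ C ∏_j ‖f_j‖_{1/s_j}` for all nonnegative `f_j`. -/
noncomputable def HBLB {G : Type*} [AddCommGroup G] {m : ℕ} {Gj : Fin m → Type*}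
    [∀ j, AddCommGroup (Gj j)] (φ : ∀ j, G →+ Gj j) (s : Fin m → ℝ) : ℝ≥0∞ :=
  sInf {C : ℝ≥0∞ | ∀ f : ∀ j, Gj j → ℝ≥0∞,
    ∑' x : G, ∏ j, f j (φ j x) ≤ C * ∏ j, HBLnorm (s j) (f j)}

/-- The quantity `A(H,s) = |H| · ∏_j |φ_j(H)|^{-s_j}` associated to a subgroup `H ≤ G`. -/
noncomputable def HBLAloc {G : Type*} [AddCommGroup G] {m : ℕ} {Gj : Fin m → Type*}
    [∀ j, AddCommGroup (Gj j)] (φ : ∀ j, G →+ Gj j) (s : Fin m → ℝ) (H : AddSubgroup G) :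
    ℝ≥0∞ :=
  (Nat.card H : ℝ≥0∞) * ∏ j, (Nat.card (H.map (φ j)) : ℝ≥0∞) ^ (-(s j))

/-- `𝔸(𝒢,s) = sup { A(H,s) : H a finite subgroup of G }`. -/
noncomputable def HBLA {G : Type*} [AddCommGroup G] {m : ℕ} {Gj : Fin m → Type*}
    [∀ j, AddCommGroup (Gj j)] (φ : ∀ j, G →+ Gj j) (s : Fin m → ℝ) : ℝ≥0∞ :=
  ⨆ (H : AddSubgroup G) (_ : (H : Set G).Finite), HBLAloc φ s H

open scoped NNReal
open Finset

/-- The condition `A(H,s) ≤ A` for every subgroup `H`, in multiplicative form. -/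
def HBLSubgroupBound {G : Type*} [AddCommGroup G] {m : ℕ} {Gj : Fin m → Type*}
    [∀ j, AddCommGroup (Gj j)] (φ : ∀ j, G →+ Gj j) (s : Fin m → ℝ) (A : ℝ≥0) : Prop :=
  ∀ H : AddSubgroup G, (Nat.card H : ℝ≥0) ≤ A * ∏ j, (Nat.card (H.map (φ j)) : ℝ≥0) ^ s j

/-- The Hölder–Brascamp–Lieb inequality with constant `A`, written for functions
`f_j = g_j ^ s_j`. -/
def HBLPowerIneq {G : Type*} [AddCommGroup G] [Fintype G] {m : ℕ} {Gj : Fin m → Type*}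
    [∀ j, AddCommGroup (Gj j)] [∀ j, Fintype (Gj j)] (φ : ∀ j, G →+ Gj j) (s : Fin m → ℝ)
    (A : ℝ≥0) : Prop :=
  ∀ g : ∀ j, Gj j → ℝ≥0∞, ∑ x, ∏ j, g j (φ j x) ^ s j ≤ A * ∏ j, (∑ y, g j y) ^ s j

theorem ENNReal.sum_rpow_mul_rpow_le {ι : Type*} (S : Finset ι) (a b : ι → ℝ≥0∞) {p q : ℝ}
    (hp : 0 < p) (hq : 0 < q) (hpq : p + q = 1) :
    ∑ i ∈ S, a i ^ p * b i ^ q ≤ (∑ i ∈ S, a i) ^ p * (∑ i ∈ S, b i) ^ q := by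
  have h : Real.HolderConjugate p⁻¹ q⁻¹ := by
    rw [Real.holderConjugate_iff]
    exact ⟨(one_lt_inv₀ hp).2 (by linarith), by simpa using hpq⟩
  have := ENNReal.inner_le_Lp_mul_Lq S (fun i => a i ^ p) (fun i => b i ^ q) h
  simpa [← ENNReal.rpow_mul, mul_inv_cancel₀ hp.ne', mul_inv_cancel₀ hq.ne'] using this

/-- Interpolation: the set of exponents for which the inequality holds with a given constant
is convex. -/
theorem HBLPowerIneq.interpolate {G : Type*} [AddCommGroup G] [Fintype G] {m : ℕ}
    {Gj : Fin m → Type*} [∀ j, AddCommGroup (Gj j)] [∀ j, Fintype (Gj j)] {φ : ∀ j, G →+ Gj j}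
    {s t u : Fin m → ℝ} {A : ℝ≥0} (hs : HBLPowerIneq φ s A) (ht : HBLPowerIneq φ t A)
    (hs0 : ∀ j, 0 ≤ s j) (ht0 : ∀ j, 0 ≤ t j) {p q : ℝ} (hp : 0 < p) (hq : 0 < q)
    (hpq : p + q = 1) (hu : ∀ j, u j = p * s j + q * t j) : HBLPowerIneq φ u A := by
  intro g
  have key : ∀ (j : Fin m) (z : ℝ≥0∞), z ^ u j = (z ^ s j) ^ p * (z ^ t j) ^ q := by
    intro j z
    rw [hu, ENNReal.rpow_add_of_nonneg _ _ (mul_nonneg hp.le (hs0 j)) (mul_nonneg hq.le (ht0 j)),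
      ← ENNReal.rpow_mul, ← ENNReal.rpow_mul, mul_comm p, mul_comm q]
  simp only [key, prod_mul_distrib, ENNReal.prod_rpow_of_nonneg hp.le,
    ENNReal.prod_rpow_of_nonneg hq.le]
  refine (ENNReal.sum_rpow_mul_rpow_le _ _ _ hp hq hpq).trans ?_
  refine (mul_le_mul' (ENNReal.rpow_le_rpow (hs g) hp.le)
    (ENNReal.rpow_le_rpow (ht g) hq.le)).trans_eq ?_
  rw [ENNReal.mul_rpow_of_nonneg _ _ hp.le, ENNReal.mul_rpow_of_nonneg _ _ hq.le,
    mul_mul_mul_comm, ← ENNReal.rpow_add_of_nonneg _ _ hp.le hq.le, hpq, ENNReal.rpow_one]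

theorem AddMonoidHom.sum_fiber_eq_sum_ker {G M N : Type*} [AddCommGroup G] [AddCommGroup M]
    [AddCommMonoid N] [Fintype G] (Φ : G →+ M) (H : AddSubgroup G) [Fintype H]
    (hH : Φ.ker = H) (F : G → N) (x₀ : G)
    [DecidablePred fun x => Φ x = Φ x₀] :
    ∑ x with Φ x = Φ x₀, F x = ∑ h : H, F (x₀ + h) := by
  subst hH
  symm
  refine sum_bij (fun h _ => x₀ + h) ?_ ?_ ?_ ?_
  · rintro ⟨h, hh⟩ -
    simpa using hh
  · intro a _ b _ hab
    exact Subtype.ext (add_left_cancel hab)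
  · intro x hx
    refine ⟨⟨x - x₀, ?_⟩, mem_univ _, by simp⟩
    simpa [AddMonoidHom.mem_ker, sub_eq_zero] using hx
  · intros
    rfl

theorem AddMonoidHom.card_range_mul_sum_comp {K M : Type*} [AddCommGroup K] [AddCommGroup M]
    [Fintype K] (ψ : K →+ M) [Fintype ψ.range] (u : M → ℝ≥0∞) :
    (Fintype.card ψ.range : ℝ≥0∞) * ∑ h, u (ψ h) = Fintype.card K * ∑ l : ψ.range, u l := by
  have h1 : ∀ l : ψ.range, ∑ h, u (ψ h + l) = ∑ h, u (ψ h) := by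
    rintro ⟨_, k, rfl⟩
    simp only [← map_add]
    exact Equiv.sum_comp (Equiv.addRight k) fun h => u (ψ h)
  have h2 : ∀ h : K, ∑ l : ψ.range, u (ψ h + l) = ∑ l : ψ.range, u l := fun h =>
    Equiv.sum_comp (Equiv.addLeft (⟨ψ h, h, rfl⟩ : ψ.range)) fun l : ψ.range => u l
  calc _ = ∑ l : ψ.range, ∑ h, u (ψ h + l) := by simp [h1]
    _ = ∑ h, ∑ l : ψ.range, u (ψ h + l) := sum_comm
    _ = _ := by simp [h2]

theorem AddMonoidHom.sum_comp_rpow_le {K M : Type*} [AddCommGroup K] [AddCommGroup M]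
    [Fintype K] [Fintype M] (ψ : K →+ M) (u : M → ℝ≥0∞) {s : ℝ} (hs0 : 0 ≤ s) (hs1 : s ≤ 1)
    {A : ℝ≥0} (hA : (Nat.card K : ℝ≥0) ≤ A * (Nat.card ψ.range : ℝ≥0) ^ s) :
    ∑ h, u (ψ h) ^ s ≤ A * (∑ y, u y) ^ s := by
  classical
  have hA' : (Fintype.card K : ℝ≥0∞) ≤ A * (Fintype.card ψ.range : ℝ≥0∞) ^ s := by
    rw [Nat.card_eq_fintype_card, Nat.card_eq_fintype_card] at hA
    have := ENNReal.coe_le_coe.2 hA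
    rw [ENNReal.coe_mul, ENNReal.coe_rpow_of_nonneg _ hs0] at this
    simpa using this
  have hL0 : (Fintype.card ψ.range : ℝ≥0∞) ^ s ≠ 0 := by
    simp [ENNReal.rpow_eq_zero_iff]
  have hLt : (Fintype.card ψ.range : ℝ≥0∞) ^ s ≠ ∞ :=
    ENNReal.rpow_ne_top_of_nonneg hs0 (by simp)
  have hjensen : ∑ h, u (ψ h) ^ s ≤ (∑ h, u (ψ h)) ^ s * (Fintype.card K : ℝ≥0∞) ^ (1 - s) := by
    rcases hs0.eq_or_lt with rfl | hs0'
    · simp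
    rcases hs1.eq_or_lt with rfl | hs1'
    · simp
    have := ENNReal.sum_rpow_mul_rpow_le univ (fun h => u (ψ h)) (fun _ => 1) hs0'
      (sub_pos.2 hs1') (by ring)
    simpa using this
  have hsum : (Fintype.card ψ.range : ℝ≥0∞) * ∑ h, u (ψ h) ≤ Fintype.card K * ∑ y, u y := by
    rw [ψ.card_range_mul_sum_comp]
    gcongr
    calc ∑ l : ψ.range, u l = ∑ y ∈ univ.map (Function.Embedding.subtype (· ∈ ψ.range)), u y := by
          rw [sum_map]; rfl
      _ ≤ ∑ y, u y := sum_le_sum_of_subset (subset_univ _)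
  rw [← ENNReal.mul_le_mul_iff_right hL0 hLt]
  calc (Fintype.card ψ.range : ℝ≥0∞) ^ s * ∑ h, u (ψ h) ^ s
      ≤ (Fintype.card ψ.range : ℝ≥0∞) ^ s *
        ((∑ h, u (ψ h)) ^ s * (Fintype.card K : ℝ≥0∞) ^ (1 - s)) := by gcongr
    _ = ((Fintype.card ψ.range : ℝ≥0∞) * ∑ h, u (ψ h)) ^ s *
        (Fintype.card K : ℝ≥0∞) ^ (1 - s) := by
      rw [ENNReal.mul_rpow_of_nonneg _ _ hs0, mul_assoc]
    _ ≤ (Fintype.card K * ∑ y, u y) ^ s * (Fintype.card K : ℝ≥0∞) ^ (1 - s) := by gcongr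
    _ = (Fintype.card K : ℝ≥0∞) ^ (s + (1 - s)) * (∑ y, u y) ^ s := by
      rw [ENNReal.mul_rpow_of_nonneg _ _ hs0,
        ENNReal.rpow_add_of_nonneg _ _ hs0 (sub_nonneg.2 hs1)]
      ring
    _ = (Fintype.card K : ℝ≥0∞) * (∑ y, u y) ^ s := by simp
    _ ≤ (A * (Fintype.card ψ.range : ℝ≥0∞) ^ s) * (∑ y, u y) ^ s := by gcongr
    _ = _ := by ring

/-- The case in which at most one exponent lies strictly between `0` and `1`. -/
theorem HBLSubgroupBound.powerIneq_of_forall_ne {G : Type*} [AddCommGroup G] [Fintype G] {m : ℕ}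
    {Gj : Fin m → Type*} [∀ j, AddCommGroup (Gj j)] [∀ j, Fintype (Gj j)] {φ : ∀ j, G →+ Gj j}
    {s : Fin m → ℝ} {A : ℝ≥0} (hP : HBLSubgroupBound φ s A) (k : Fin m)
    (hk : s k ∈ Set.Icc (0 : ℝ) 1) (h01 : ∀ j, j ≠ k → s j = 0 ∨ s j = 1) :
    HBLPowerIneq φ s A := by
  classical
  intro g
  set J := {j : Fin m // j ≠ k ∧ s j = 1}
  have hprod : ∀ f : ∀ j, ℝ≥0∞, ∏ j, f j ^ s j = f k ^ s k * ∏ j : J, f j := by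
    intro f
    rw [← mul_prod_erase _ _ (mem_univ k)]
    congr 1
    rw [← prod_subtype (univ.filter fun j => j ≠ k ∧ s j = 1) (by simp) f, prod_filter,
      ← mul_prod_erase univ _ (mem_univ k)]
    simp only [ne_eq, not_true_eq_false, false_and, if_false, one_mul]
    refine prod_congr rfl fun j hj => ?_
    rcases h01 j (ne_of_mem_erase hj) with h | h
    · simp [h]
    · simp [h, ne_of_mem_erase hj]
  let Φ : G →+ ∀ j : J, Gj j := AddMonoidHom.mk' (fun x j => φ j x) (by intro a b; ext j; simp)
  have hbound : ∀ x₀ : G, ∑ x with Φ x = Φ x₀, g k (φ k x) ^ s k ≤ A * (∑ y, g k y) ^ s k := by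
    intro x₀
    rw [Φ.sum_fiber_eq_sum_ker Φ.ker rfl]
    simp only [map_add]
    refine (((φ k).comp Φ.ker.subtype).sum_comp_rpow_le (fun y => g k (φ k x₀ + y))
      hk.1 hk.2 (A := A) ?_).trans_eq ?_
    · refine (hP Φ.ker).trans_eq ?_
      rw [AddMonoidHom.range_comp, AddSubgroup.range_subtype]
      congr 1
      rw [← mul_prod_erase _ _ (mem_univ k)]
      rw [prod_eq_one, mul_one]
      intro j hj
      rcases h01 j (ne_of_mem_erase hj) with h | h
      · simp [h]
      · have : Φ.ker.map (φ j) = ⊥ := by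
          rw [AddSubgroup.map_eq_bot_iff]
          intro x hx
          exact congr_fun (AddMonoidHom.mem_ker.1 hx) ⟨j, ne_of_mem_erase hj, h⟩
        simp [this]
    · congr 2
      exact Equiv.sum_comp (Equiv.addLeft (φ k x₀)) (g k)
  have hfiber : ∀ z : ∀ j : J, Gj j,
      ∑ x with Φ x = z, g k (φ k x) ^ s k * ∏ j : J, g j (φ j x)
        ≤ A * (∑ y, g k y) ^ s k * ∏ j : J, g j (z j) := by
    intro z
    by_cases hz : ∃ x₀, Φ x₀ = z
    · obtain ⟨x₀, rfl⟩ := hz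
      refine le_trans (le_of_eq ?_) (mul_le_mul_left (hbound x₀) _)
      rw [sum_mul]
      refine sum_congr rfl fun x hx => ?_
      congr 1
      refine prod_congr rfl fun j _ => ?_
      rw [← (mem_filter.1 hx).2]
      rfl
    · rw [filter_false_of_mem (fun x _ hx => hz ⟨x, hx⟩)]
      simp
  rw [hprod fun j => ∑ y, g j y, prod_univ_sum, Fintype.piFinset_univ]
  simp only [fun x => hprod fun j => g j (φ j x)]
  rw [← sum_fiberwise univ Φ, ← mul_assoc, mul_sum]
  exact sum_le_sum fun z _ => hfiber z

theorem AddSubgroup.card_map_mk_mul_card {G : Type*} [AddCommGroup G] {N K : AddSubgroup G}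
    (h : N ≤ K) : Nat.card (K.map (QuotientAddGroup.mk' N)) * Nat.card N = Nat.card K := by
  rw [← AddSubgroup.relIndex_ker, QuotientAddGroup.ker_mk', mul_comm,
    ← AddSubgroup.relIndex_bot_left, AddSubgroup.relIndex_mul_relIndex _ _ _ bot_le h,
    AddSubgroup.relIndex_bot_left]

/-- The quotient homomorphism `G ⧸ H → G_j ⧸ φ_j(H)`. -/
def hblQuotientMap {G G' : Type*} [AddCommGroup G] [AddCommGroup G'] (φ : G →+ G')
    (H : AddSubgroup G) : G ⧸ H →+ G' ⧸ H.map φ :=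
  QuotientAddGroup.map H (H.map φ) φ (AddSubgroup.le_comap_map φ H)

theorem HBLSubgroupBound.restrict {G : Type*} [AddCommGroup G] {m : ℕ}
    {Gj : Fin m → Type*} [∀ j, AddCommGroup (Gj j)] {φ : ∀ j, G →+ Gj j}
    {s : Fin m → ℝ} {A : ℝ≥0} (hP : HBLSubgroupBound φ s A) (H : AddSubgroup G) :
    HBLSubgroupBound (fun j => (φ j).comp H.subtype) s A := by
  intro L
  have := hP (L.map H.subtype)
  simp only [AddSubgroup.map_map] at this
  rwa [Nat.card_congr (L.equivMapOfInjective H.subtype H.subtype_injective).toEquiv.symm] at this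

theorem HBLSubgroupBound.quotient {G : Type*} [AddCommGroup G] [Finite G] {m : ℕ}
    {Gj : Fin m → Type*} [∀ j, AddCommGroup (Gj j)] {φ : ∀ j, G →+ Gj j}
    {s : Fin m → ℝ} {A : ℝ≥0} (hP : HBLSubgroupBound φ s A) {H : AddSubgroup G}
    (hH : (Nat.card H : ℝ≥0) = A * ∏ j, (Nat.card (H.map (φ j)) : ℝ≥0) ^ s j) :
    HBLSubgroupBound (fun j => hblQuotientMap (φ j) H) s 1 := by
  intro K'
  set K := K'.comap (QuotientAddGroup.mk' H) with hK
  have hKK' : K.map (QuotientAddGroup.mk' H) = K' :=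
    AddSubgroup.map_comap_eq_self_of_surjective (QuotientAddGroup.mk'_surjective H) K'
  have hHK : H ≤ K := by
    intro x hx
    have : (QuotientAddGroup.mk' H) x = 0 := (QuotientAddGroup.eq_zero_iff x).2 hx
    rw [hK, AddSubgroup.mem_comap, this]
    exact K'.zero_mem
  have hcard : (Nat.card K : ℝ≥0) = Nat.card K' * Nat.card H := by
    rw [← AddSubgroup.card_map_mk_mul_card hHK, hKK', Nat.cast_mul]
  have hcardj : ∀ j, (Nat.card (K.map (φ j)) : ℝ≥0)
      = Nat.card (K'.map (hblQuotientMap (φ j) H)) * Nat.card (H.map (φ j)) := by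
    intro j
    rw [← AddSubgroup.card_map_mk_mul_card (AddSubgroup.map_mono hHK), Nat.cast_mul]
    congr 3
    rw [← hKK', AddSubgroup.map_map, AddSubgroup.map_map]
    rfl
  have hpos : (0 : ℝ≥0) < Nat.card H := by exact_mod_cast Nat.card_pos
  have := hP K
  rw [hcard] at this
  simp only [hcardj, NNReal.mul_rpow, prod_mul_distrib] at this
  rw [mul_left_comm, ← hH] at this
  rw [one_mul]
  exact le_of_mul_le_mul_right this hpos

open Classical in
/-- The inequality for `G` follows from those for a subgroup `H` and for the quotient. -/
theorem HBLPowerIneq.of_subgroup_of_quotient {G : Type*} [AddCommGroup G] [Fintype G] {m : ℕ}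
    {Gj : Fin m → Type*} [∀ j, AddCommGroup (Gj j)] [∀ j, Fintype (Gj j)] {φ : ∀ j, G →+ Gj j}
    {s : Fin m → ℝ} {A B : ℝ≥0} (H : AddSubgroup G)
    (h₁ : HBLPowerIneq (fun j => (φ j).comp H.subtype) s A)
    (h₂ : HBLPowerIneq (fun j => hblQuotientMap (φ j) H) s B) :
    HBLPowerIneq φ s (A * B) := by
  intro g
  let γ : ∀ j, Gj j ⧸ H.map (φ j) → ℝ≥0∞ :=
    fun j c => ∑ y with QuotientAddGroup.mk' (H.map (φ j)) y = c, g j y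
  have hγ : ∀ j, ∑ c, γ j c = ∑ y, g j y := fun j => sum_fiberwise univ _ _
  have hfiber : ∀ c : G ⧸ H,
      ∑ x with QuotientAddGroup.mk' H x = c, ∏ j, g j (φ j x) ^ s j
        ≤ A * ∏ j, γ j (hblQuotientMap (φ j) H c) ^ s j := by
    intro c
    obtain ⟨x₀, rfl⟩ := QuotientAddGroup.mk'_surjective H c
    rw [AddMonoidHom.sum_fiber_eq_sum_ker _ H (QuotientAddGroup.ker_mk' H)]
    let u : ∀ j, Gj j → ℝ≥0∞ := fun j y =>
      if QuotientAddGroup.mk' (H.map (φ j)) (φ j x₀ + y) =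
        QuotientAddGroup.mk' (H.map (φ j)) (φ j x₀) then g j (φ j x₀ + y) else 0
    have hu : ∀ j (h : H), u j (φ j h) = g j (φ j (x₀ + h)) := by
      intro j h
      have h0 : QuotientAddGroup.mk' (H.map (φ j)) (φ j h) = 0 :=
        (QuotientAddGroup.eq_zero_iff _).2 ⟨h, h.2, rfl⟩
      simp only [u, map_add, h0, add_zero, if_true]
    have hsum : ∀ j, ∑ y, u j y = γ j (hblQuotientMap (φ j) H (QuotientAddGroup.mk' H x₀)) := by
      intro j
      refine (Equiv.sum_comp (Equiv.addLeft (φ j x₀)) fun y =>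
        if QuotientAddGroup.mk' (H.map (φ j)) y = QuotientAddGroup.mk' (H.map (φ j)) (φ j x₀)
        then g j y else 0).trans ?_
      rw [← sum_filter]
      rfl
    have := h₁ u
    simp only [hsum] at this
    refine le_trans (le_of_eq ?_) this
    refine sum_congr rfl fun h _ => prod_congr rfl fun j _ => ?_
    rw [← hu]
    rfl
  rw [← sum_fiberwise univ (QuotientAddGroup.mk' H)]
  refine (sum_le_sum fun c _ => hfiber c).trans ?_
  rw [← mul_sum, ENNReal.coe_mul, mul_assoc]
  simp only [← hγ]
  gcongr
  exact h₂ γ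

theorem continuous_prod_natCard_rpow {m : ℕ} (c : Fin m → ℝ≥0) (hc : ∀ j, c j ≠ 0)
    (s v : Fin m → ℝ) : Continuous fun t : ℝ => ∏ j, c j ^ (s j + t * v j) := by
  refine continuous_finsetProd _ fun j _ => ?_
  rw [continuous_iff_continuousAt]
  intro t
  exact continuousAt_const.nnrpow
    (Continuous.continuousAt (f := fun t : ℝ => s j + t * v j) (by fun_prop)) (Or.inl (hc j))

theorem HBLSubgroupBound.exists_boundary {G : Type*} [AddCommGroup G] [Finite G] {m : ℕ}
    {Gj : Fin m → Type*} [∀ j, AddCommGroup (Gj j)] {φ : ∀ j, G →+ Gj j}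
    {s : Fin m → ℝ} {A : ℝ≥0} (hP : HBLSubgroupBound φ s A)
    (hs : ∀ j, s j ∈ Set.Icc (0 : ℝ) 1) (v : Fin m → ℝ) (hv : ∃ j, v j ≠ 0)
    (hG : ∏ j, (Nat.card ((⊤ : AddSubgroup G).map (φ j)) : ℝ≥0) ^ v j = 1) :
    ∃ t : ℝ, 0 ≤ t ∧ (∀ j, s j + t * v j ∈ Set.Icc (0 : ℝ) 1) ∧
      HBLSubgroupBound φ (fun j => s j + t * v j) A ∧
      ((∃ j, v j ≠ 0 ∧ (s j + t * v j = 0 ∨ s j + t * v j = 1)) ∨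
        ∃ H : AddSubgroup G, H ≠ ⊥ ∧ H ≠ ⊤ ∧
          (Nat.card H : ℝ≥0) = A * ∏ j, (Nat.card (H.map (φ j)) : ℝ≥0) ^ (s j + t * v j)) := by
  have hne : ∀ (H : AddSubgroup G) j, (Nat.card (H.map (φ j)) : ℝ≥0) ≠ 0 := by
    intro H j
    have : Finite (H.map (φ j)) := Set.Finite.image (φ j) (Set.toFinite (H : Set G))
    exact_mod_cast Nat.card_pos.ne'
  have hcont : ∀ H : AddSubgroup G, Continuous fun t : ℝ =>
      A * ∏ j, (Nat.card (H.map (φ j)) : ℝ≥0) ^ (s j + t * v j) := fun H =>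
    continuous_const.mul (continuous_prod_natCard_rpow _ (hne H) s v)
  have hbot : ∀ t : ℝ, ∏ j, (Nat.card ((⊥ : AddSubgroup G).map (φ j)) : ℝ≥0) ^ (s j + t * v j)
      = ∏ j, (Nat.card ((⊥ : AddSubgroup G).map (φ j)) : ℝ≥0) ^ s j := by
    intro t
    simp
  have htop : ∀ t : ℝ, ∏ j, (Nat.card ((⊤ : AddSubgroup G).map (φ j)) : ℝ≥0) ^ (s j + t * v j)
      = ∏ j, (Nat.card ((⊤ : AddSubgroup G).map (φ j)) : ℝ≥0) ^ s j := by
    intro t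
    simp only [NNReal.rpow_add (hne ⊤ _), prod_mul_distrib, mul_comm t, NNReal.rpow_mul]
    rw [NNReal.finsetProd_rpow, hG, NNReal.one_rpow, mul_one]
  set T : Set ℝ := {t | 0 ≤ t ∧ (∀ j, s j + t * v j ∈ Set.Icc (0 : ℝ) 1) ∧
    HBLSubgroupBound φ (fun j => s j + t * v j) A} with hT
  have hclosed : IsClosed T := by
    simp only [hT, HBLSubgroupBound, Set.ofPred_and, Set.ofPred_forall]
    refine (isClosed_le continuous_const continuous_id).inter
      ((isClosed_iInter fun j => isClosed_Icc.preimage (by fun_prop)).inter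
        (isClosed_iInter fun H => isClosed_le continuous_const (hcont H)))
  have hbdd : BddAbove T := by
    obtain ⟨j, hj⟩ := hv
    refine ⟨1 / |v j|, ?_⟩
    rintro t ⟨h0, h1, -⟩
    rw [le_div_iff₀ (abs_pos.2 hj), ← abs_of_nonneg h0, ← abs_mul, abs_le]
    have := h1 j
    have := hs j
    simp only [Set.mem_Icc] at *
    constructor <;> linarith
  have hmem : sSup T ∈ T :=
    hclosed.csSup_mem ⟨0, le_rfl, by simpa using hs, by simpa using hP⟩ hbdd
  obtain ⟨h0, h1, h2⟩ := hmem
  refine ⟨sSup T, h0, h1, h2, ?_⟩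
  by_contra! hcon
  obtain ⟨hc1, hc2⟩ := hcon
  have hev : ∀ᶠ t in nhdsWithin (sSup T) (Set.Ioi (sSup T)), t ∈ T := by
    have hcube : ∀ᶠ t in nhds (sSup T), ∀ j, s j + t * v j ∈ Set.Icc (0 : ℝ) 1 := by
      rw [Filter.eventually_all]
      intro j
      by_cases hj : v j = 0
      · simpa [hj] using hs j
      · have hmem : s j + sSup T * v j ∈ Set.Ioo (0 : ℝ) 1 :=
          ⟨lt_of_le_of_ne (h1 j).1 (hc1 j hj).1.symm, lt_of_le_of_ne (h1 j).2 (hc1 j hj).2⟩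
        have hct : Continuous fun t : ℝ => s j + t * v j := by fun_prop
        exact (hct.continuousAt.eventually (isOpen_Ioo.mem_nhds hmem)).mono
          fun t ht => Set.Ioo_subset_Icc_self ht
    have hsub : ∀ᶠ t in nhds (sSup T), ∀ H : AddSubgroup G,
        (Nat.card H : ℝ≥0) ≤ A * ∏ j, (Nat.card (H.map (φ j)) : ℝ≥0) ^ (s j + t * v j) := by
      rw [Filter.eventually_all]
      intro H
      by_cases hb : H = ⊥
      · subst hb
        exact Filter.Eventually.of_forall fun t => by rw [hbot]; exact hP ⊥
      by_cases ht : H = ⊤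
      · subst ht
        exact Filter.Eventually.of_forall fun t => by rw [htop]; exact hP ⊤
      exact (((hcont H).continuousAt.eventually
        (isOpen_Ioi.mem_nhds (lt_of_le_of_ne (h2 H) (hc2 H hb ht))))).mono fun t ht => le_of_lt ht
    filter_upwards [nhdsWithin_le_nhds hcube, nhdsWithin_le_nhds hsub, self_mem_nhdsWithin]
      with t ha hb hlt
    exact ⟨h0.trans (le_of_lt hlt), ha, hb⟩
  obtain ⟨t, htT, hlt⟩ := (hev.and self_mem_nhdsWithin).exists
  exact absurd (le_csSup hbdd htT) (not_le.2 hlt)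

theorem exists_ne_zero_prod_rpow_eq_one {m : ℕ} (c : Fin m → ℝ≥0) (hc : ∀ j, c j ≠ 0)
    {j k : Fin m} (hjk : j ≠ k) :
    ∃ v : Fin m → ℝ, (∃ i, v i ≠ 0) ∧ (∀ i, v i ≠ 0 → i = j ∨ i = k) ∧ ∏ i, c i ^ v i = 1 := by
  classical
  by_cases h1 : c j = 1
  · refine ⟨Pi.single j 1, ⟨j, by simp⟩, fun i hi => Or.inl ?_, ?_⟩
    · by_contra h
      simp [h] at hi
    · refine prod_eq_one fun i _ => ?_
      by_cases h : i = j
      · subst h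
        simp [h1]
      · simp [h]
  · have hpos : ∀ i, (0 : ℝ) < c i := fun i => NNReal.coe_pos.2 (pos_iff_ne_zero.2 (hc i))
    have hlog : Real.log (c j) ≠ 0 :=
      Real.log_ne_zero_of_pos_of_ne_one (hpos j) (by exact_mod_cast h1)
    refine ⟨fun i => if i = j then -Real.log (c k) else if i = k then Real.log (c j) else 0,
      ⟨k, by simp [hjk.symm, -Real.log_eq_zero, hlog]⟩, fun i hi => ?_, ?_⟩
    · by_contra! h
      simp [h.1, h.2] at hi
    · rw [← mul_prod_erase univ _ (mem_univ j),
        ← mul_prod_erase (univ.erase j) _ (mem_erase.2 ⟨hjk.symm, mem_univ k⟩), prod_eq_one,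
        mul_one]
      · simp only [if_true, if_neg hjk.symm]
        rw [← NNReal.coe_inj]
        push_cast
        rw [Real.rpow_def_of_pos (hpos j), Real.rpow_def_of_pos (hpos k), ← Real.exp_add]
        simp [mul_comm]
      · intro i hi
        simp only [mem_erase, mem_univ, and_true] at hi
        simp [hi.1, hi.2]

theorem HBLSubgroupBound.powerIneq {m : ℕ} (hm : 0 < m) (n : ℕ) :
    ∀ {G : Type*} [AddCommGroup G] [Fintype G] {Gj : Fin m → Type*} [∀ j, AddCommGroup (Gj j)]
      [∀ j, Fintype (Gj j)] {φ : ∀ j, G →+ Gj j} {s : Fin m → ℝ} {A : ℝ≥0},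
      Nat.card G = n → (∀ j, s j ∈ Set.Icc (0 : ℝ) 1) → HBLSubgroupBound φ s A →
        HBLPowerIneq φ s A := by
  classical
  induction n using Nat.strong_induction_on with
  | _ n ihn =>
  intro G _ _ Gj _ _ φ s A hn hs hP
  have hcrit : ∀ {s : Fin m → ℝ}, (∀ j, s j ∈ Set.Icc (0 : ℝ) 1) → HBLSubgroupBound φ s A →
      ∀ H : AddSubgroup G, H ≠ ⊥ → H ≠ ⊤ →
        (Nat.card H : ℝ≥0) = A * ∏ j, (Nat.card (H.map (φ j)) : ℝ≥0) ^ s j →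
        HBLPowerIneq φ s A := by
    intro s hs hP H hbot htop hH
    have hone : 1 < Nat.card H := by
      rw [AddSubgroup.one_lt_card_iff_ne_bot]
      exact hbot
    have hlt : Nat.card H < Nat.card G :=
      lt_of_le_of_ne (AddSubgroup.card_le_card_addGroup H)
        fun h => htop (AddSubgroup.eq_top_of_card_eq H h)
    have hquot : Nat.card (G ⧸ H) < Nat.card G := by
      rw [AddSubgroup.card_eq_card_quotient_mul_card_addSubgroup H]
      exact lt_mul_of_one_lt_right Nat.card_pos hone
    rw [← mul_one A]
    exact HBLPowerIneq.of_subgroup_of_quotient H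
      (ihn _ (hn ▸ hlt) rfl hs (hP.restrict H)) (ihn _ (hn ▸ hquot) rfl hs (hP.quotient hH))
  generalize hN : #{j | s j ≠ 0 ∧ s j ≠ 1} = N
  induction N using Nat.strong_induction_on generalizing s with
  | _ N ihN =>
  by_cases htwo : ∃ j k, j ≠ k ∧ (s j ≠ 0 ∧ s j ≠ 1) ∧ (s k ≠ 0 ∧ s k ≠ 1)
  · obtain ⟨j, k, hjk, hj, hk⟩ := htwo
    obtain ⟨v, hv0, hvsupp, hvG⟩ := exists_ne_zero_prod_rpow_eq_one
      (fun i => (Nat.card ((⊤ : AddSubgroup G).map (φ i)) : ℝ≥0))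
      (fun i => by exact_mod_cast Nat.card_pos.ne') hjk
    have hstep : ∀ w : Fin m → ℝ, (∃ i, w i ≠ 0) → (∀ i, w i ≠ 0 → i = j ∨ i = k) →
        ∏ i, (Nat.card ((⊤ : AddSubgroup G).map (φ i)) : ℝ≥0) ^ w i = 1 →
        ∃ t : ℝ, 0 ≤ t ∧ (∀ i, s i + t * w i ∈ Set.Icc (0 : ℝ) 1) ∧
          HBLPowerIneq φ (fun i => s i + t * w i) A := by
      intro w hw0 hwsupp hwG
      obtain ⟨t, ht, hcube, hbound, ⟨i, hi, hi01⟩ | ⟨H, hbot, htop, hH⟩⟩ :=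
        hP.exists_boundary hs w hw0 hwG
      · refine ⟨t, ht, hcube, ihN _ ?_ hcube hbound rfl⟩
        rw [← hN]
        refine card_lt_card (ssubset_iff_of_subset ?_ |>.2 ⟨i, ?_, ?_⟩)
        · intro l hl
          by_cases hwl : w l = 0
          · simpa [hwl] using hl
          · rcases hwsupp l hwl with rfl | rfl
            · simpa using hj
            · simpa using hk
        · rcases hwsupp i hi with rfl | rfl
          · simpa using hj
          · simpa using hk
        · rcases hi01 with h | h <;> simp [h]
      · exact ⟨t, ht, hcube, hcrit hcube hbound H hbot htop hH⟩
    obtain ⟨t₁, ht₁, hc₁, hQ₁⟩ := hstep v hv0 hvsupp hvG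
    obtain ⟨t₂, ht₂, hc₂, hQ₂⟩ := hstep (-v) (by simpa using hv0) (by simpa using hvsupp)
      (by simp only [Pi.neg_apply, NNReal.rpow_neg, prod_inv_distrib, hvG, inv_one])
    rcases ht₁.eq_or_lt with rfl | ht₁
    · simpa using hQ₁
    rcases ht₂.eq_or_lt with rfl | ht₂
    · simpa using hQ₂
    refine hQ₁.interpolate hQ₂ (fun i => (hc₁ i).1) (fun i => (hc₂ i).1)
      (p := t₂ / (t₁ + t₂)) (q := t₁ / (t₁ + t₂)) (by positivity) (by positivity)
      (by field_simp; ring) fun i => ?_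
    simp only [Pi.neg_apply]
    field_simp
    ring
  · push Not at htwo
    by_cases hone : ∃ k, s k ≠ 0 ∧ s k ≠ 1
    · obtain ⟨k, hk⟩ := hone
      refine hP.powerIneq_of_forall_ne k (hs k) fun j hj => ?_
      by_contra! h
      exact hk.2 (htwo j k hj h hk.1)
    · push Not at hone
      exact hP.powerIneq_of_forall_ne ⟨0, hm⟩ (hs _) fun j _ => or_iff_not_imp_left.2 (hone j)

theorem HBLPowerIneq.hblB_le {G : Type*} [AddCommGroup G] [Fintype G] {m : ℕ}
    {Gj : Fin m → Type*} [∀ j, AddCommGroup (Gj j)] [∀ j, Fintype (Gj j)] {φ : ∀ j, G →+ Gj j}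
    {s : Fin m → ℝ} {A : ℝ≥0} (h : HBLPowerIneq φ s A) : HBLB φ s ≤ A := by
  refine sInf_le fun f => ?_
  let n : Fin m → ℝ≥0∞ := fun j => if s j = 0 then ⨆ y, f j y else 1
  let g : ∀ j, Gj j → ℝ≥0∞ := fun j y => f j y ^ (1 / s j)
  have hf : ∀ j y, f j y ≤ n j * g j y ^ s j := by
    intro j y
    by_cases hj : s j = 0
    · simpa [n, hj] using le_iSup (f j) y
    · simp [n, g, hj, ← ENNReal.rpow_mul]
  have hnorm : ∀ j, HBLnorm (s j) (f j) = n j * (∑ y, g j y) ^ s j := by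
    intro j
    by_cases hj : s j = 0
    · simp [HBLnorm, n, hj]
    · simp [HBLnorm, n, g, hj, tsum_fintype]
  simp only [hnorm, tsum_fintype, prod_mul_distrib]
  calc ∑ x, ∏ j, f j (φ j x) ≤ ∑ x, ∏ j, (n j * g j (φ j x) ^ s j) :=
        sum_le_sum fun x _ => prod_le_prod' fun j _ => hf j _
    _ = (∏ j, n j) * ∑ x, ∏ j, g j (φ j x) ^ s j := by simp only [prod_mul_distrib, mul_sum]
    _ ≤ (∏ j, n j) * (A * ∏ j, (∑ y, g j y) ^ s j) := by
        gcongr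
        exact h g
    _ = _ := by ring

theorem hblA_ne_top {G : Type*} [AddCommGroup G] [Finite G] {m : ℕ} {Gj : Fin m → Type*}
    [∀ j, AddCommGroup (Gj j)] (φ : ∀ j, G →+ Gj j) {s : Fin m → ℝ} (hs : ∀ j, 0 ≤ s j) :
    HBLA φ s ≠ ∞ := by
  refine ne_top_of_le_ne_top (ENNReal.natCast_ne_top (Nat.card G))
    (iSup₂_le fun H _ => ?_)
  refine mul_le_of_le_of_le_one (Nat.cast_le.2 (AddSubgroup.card_le_card_addGroup H))
    (prod_le_one' fun j _ => ?_)
  have : Finite (H.map (φ j)) := Set.Finite.image (φ j) (Set.toFinite (H : Set G))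
  rw [ENNReal.rpow_neg, ENNReal.inv_le_one]
  calc (1 : ℝ≥0∞) = 1 ^ s j := (ENNReal.one_rpow _).symm
    _ ≤ _ := ENNReal.rpow_le_rpow (by exact_mod_cast Nat.card_pos) (hs j)

theorem hblSubgroupBound_hblA {G : Type*} [AddCommGroup G] [Finite G] {m : ℕ}
    {Gj : Fin m → Type*} [∀ j, AddCommGroup (Gj j)] (φ : ∀ j, G →+ Gj j) {s : Fin m → ℝ}
    (hs : ∀ j, 0 ≤ s j) : HBLSubgroupBound φ s (HBLA φ s).toNNReal := by
  intro H
  rw [← ENNReal.coe_le_coe, ENNReal.coe_mul, ENNReal.coe_toNNReal (hblA_ne_top φ hs)]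
  push_cast
  simp only [ENNReal.coe_rpow_of_nonneg _ (hs _), ENNReal.coe_natCast]
  have hle : HBLAloc φ s H ≤ HBLA φ s := le_iSup₂_of_le H (Set.toFinite _) le_rfl
  refine le_trans (le_of_eq ?_) (mul_le_mul_left hle _)
  rw [HBLAloc, mul_assoc, ← prod_mul_distrib, prod_eq_one, mul_one]
  intro j _
  have : Finite (H.map (φ j)) := Set.Finite.image (φ j) (Set.toFinite (H : Set G))
  have h0 : (Nat.card (H.map (φ j)) : ℝ≥0∞) ≠ 0 := by exact_mod_cast Nat.card_pos.ne'
  rw [← ENNReal.rpow_add _ _ h0 (ENNReal.natCast_ne_top _), neg_add_cancel, ENNReal.rpow_zero]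

theorem hblA_le_hblB {G : Type*} [AddCommGroup G] [Fintype G] {m : ℕ} {Gj : Fin m → Type*}
    [∀ j, AddCommGroup (Gj j)] [∀ j, Fintype (Gj j)] (φ : ∀ j, G →+ Gj j) (s : Fin m → ℝ)
    (hs : ∀ j, 0 ≤ s j) : HBLA φ s ≤ HBLB φ s := by
  classical
  refine iSup₂_le fun H _ => le_sInf fun C hC => ?_
  let f : ∀ j, Gj j → ℝ≥0∞ := fun j y => if y ∈ H.map (φ j) then 1 else 0
  have hnorm : ∀ j, HBLnorm (s j) (f j) ≤ (Nat.card (H.map (φ j)) : ℝ≥0∞) ^ s j := by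
    intro j
    by_cases hj : s j = 0
    · simp only [HBLnorm, hj, if_true, ENNReal.rpow_zero]
      exact iSup_le fun y => by dsimp only [f]; split_ifs <;> simp
    · have hpos : 0 < (s j)⁻¹ := inv_pos.2 (lt_of_le_of_ne (hs j) (Ne.symm hj))
      have : ∀ y, f j y ^ (1 / s j) = f j y := by
        intro y
        dsimp only [f]
        split_ifs <;> simp [hpos]
      simp only [HBLnorm, hj, if_false, this, tsum_fintype]
      simp [f, Nat.card_eq_fintype_card, Fintype.card_subtype]
  have hsum : (Nat.card H : ℝ≥0∞) ≤ ∑' x, ∏ j, f j (φ j x) := by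
    rw [tsum_fintype, Nat.card_eq_fintype_card, Fintype.card_subtype, card_eq_sum_ones,
      Nat.cast_sum]
    refine le_trans (sum_le_sum fun x hx => ?_) (sum_le_sum_of_subset (subset_univ _))
    rw [prod_eq_one, Nat.cast_one]
    intro j _
    exact if_pos (AddSubgroup.mem_map_of_mem _ (mem_filter.1 hx).2)
  calc HBLAloc φ s H
      ≤ (C * ∏ j, (Nat.card (H.map (φ j)) : ℝ≥0∞) ^ s j) *
          ∏ j, (Nat.card (H.map (φ j)) : ℝ≥0∞) ^ (-(s j)) := by
        refine mul_le_mul_left ((hsum.trans (hC f)).trans ?_) _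
        gcongr with j
        exact hnorm j
    _ = C := by
        rw [mul_assoc, ← prod_mul_distrib, prod_eq_one, mul_one]
        intro j _
        have h0 : (Nat.card (H.map (φ j)) : ℝ≥0∞) ≠ 0 := by exact_mod_cast Nat.card_pos.ne'
        rw [← ENNReal.rpow_add _ _ h0 (ENNReal.natCast_ne_top _), add_neg_cancel,
          ENNReal.rpow_zero]

/-- **Theorem (finite groups).** For a finite Abelian group HBL datum `𝒢` and any
`s ∈ [0,1]^m`, the optimal constant satisfies `𝔹(𝒢,s) = 𝔸(𝒢,s)`. -/
theorem finite_HBL_optimal_constant {G : Type*} [AddCommGroup G] [Fintype G]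
    {m : ℕ} (hm : 0 < m) {Gj : Fin m → Type*} [∀ j, AddCommGroup (Gj j)]
    [∀ j, Fintype (Gj j)] (φ : ∀ j, G →+ Gj j)
    (s : Fin m → ℝ) (hs : ∀ j, s j ∈ Set.Icc (0 : ℝ) 1) :
    HBLB φ s = HBLA φ s := by
  have hs0 : ∀ j, 0 ≤ s j := fun j => (hs j).1
  refine le_antisymm ?_ (hblA_le_hblB φ s hs0)
  rw [← ENNReal.coe_toNNReal (hblA_ne_top φ hs0)]
  exact ((hblSubgroupBound_hblA φ hs0).powerIneq hm _ rfl hs).hblB_le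
end

section
/- Let 𝒢 = (φ_j : G → G_j : 1 ≤ j ≤ m) be an arbitrary Abelian group HBL datum and let s ∈ 𝒫(𝒢). Then 𝔹(𝒢,s) = 𝔸(𝒢,s). -/
open scoped ENNReal

/-- The polytope `𝒫(𝒢)`: the set of `s ∈ [0,1]^m` such that
`rank(H) ≤ ∑_j s_j · rank(φ_j(H))` for every subgroup `H ≤ G` of finite (torsion-free)
rank, where the rank is the maximal number of `ℤ`-linearly independent elements,
i.e. `Module.rank ℤ`. -/
def HBLP {G : Type*} [AddCommGroup G] {m : ℕ} {Gj : Fin m → Type*}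
    [∀ j, AddCommGroup (Gj j)] (φ : ∀ j, G →+ Gj j) (s : Fin m → ℝ) : Prop :=
  (∀ j, s j ∈ Set.Icc (0 : ℝ) 1) ∧
  ∀ H : AddSubgroup G, Module.rank ℤ H < Cardinal.aleph0 →
    ((Module.rank ℤ H).toNat : ℝ) ≤ ∑ j, s j * ((Module.rank ℤ (H.map (φ j))).toNat : ℝ)

/-- The inequality `∑_x ∏_j p_j(φ_j x)^{s_j} ≤ C ∏_j (∑ p_j)^{s_j}` for all nonnegative `p_j`,
which is the Hölder–Brascamp–Lieb inequality after the substitution `f_j = p_j^{s_j}`. -/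
def HBLHolds {G : Type*} [AddCommGroup G] {m : ℕ} {Gj : Fin m → Type*}
    [∀ j, AddCommGroup (Gj j)] (φ : ∀ j, G →+ Gj j) (s : Fin m → ℝ) (C : ℝ≥0∞) : Prop :=
  ∀ p : ∀ j, Gj j → ℝ≥0∞,
    ∑' x : G, ∏ j, p j (φ j x) ^ s j ≤ C * ∏ j, (∑' y, p j y) ^ s j

section

variable {G : Type*} [AddCommGroup G] {m : ℕ} {Gj : Fin m → Type*}
  [∀ j, AddCommGroup (Gj j)] {φ : ∀ j, G →+ Gj j} {s : Fin m → ℝ} {C : ℝ≥0∞}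

theorem HBLHolds.le_norm (h : HBLHolds φ s C) (f : ∀ j, Gj j → ℝ≥0∞) :
    ∑' x : G, ∏ j, f j (φ j x) ≤ C * ∏ j, HBLnorm (s j) (f j) := by
  set c : Fin m → ℝ≥0∞ := fun j => if s j = 0 then ⨆ y, f j y else 1 with hc
  have hf : ∀ j y, f j y ≤ c j * (f j y ^ (1 / s j)) ^ s j := by
    intro j y
    by_cases h0 : s j = 0
    · simpa [hc, h0] using le_iSup (f j) y
    · simp [hc, h0, ← ENNReal.rpow_mul]
  calc ∑' x : G, ∏ j, f j (φ j x)
      ≤ ∑' x : G, ∏ j, (c j * (f j (φ j x) ^ (1 / s j)) ^ s j) :=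
        ENNReal.tsum_le_tsum fun x => Finset.prod_le_prod' fun j _ => hf j _
    _ = (∏ j, c j) * ∑' x : G, ∏ j, (f j (φ j x) ^ (1 / s j)) ^ s j := by
        simp only [Finset.prod_mul_distrib, ENNReal.tsum_mul_left]
    _ ≤ (∏ j, c j) * (C * ∏ j, (∑' y, f j y ^ (1 / s j)) ^ s j) := by
        gcongr
        exact h fun j y => f j y ^ (1 / s j)
    _ = C * ∏ j, (c j * (∑' y, f j y ^ (1 / s j)) ^ s j) := by
        rw [Finset.prod_mul_distrib]; ring
    _ = C * ∏ j, HBLnorm (s j) (f j) := by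
        congr 1
        refine Finset.prod_congr rfl fun j _ => ?_
        by_cases h0 : s j = 0 <;> simp [hc, h0, HBLnorm]

/-- A Hölder–Brascamp–Lieb inequality on a group follows from the ones on a subgroup and on the
corresponding quotient. -/
theorem HBLHolds.of_subgroup_of_quotient (V : AddSubgroup G)
    {C₁ C₂ : ℝ≥0∞} (h₁ : HBLHolds (fun j => (φ j).comp V.subtype) s C₁)
    (h₂ : HBLHolds (fun j => QuotientAddGroup.map V (V.map (φ j)) (φ j)
      (AddSubgroup.le_comap_map _ _)) s C₂) :
    HBLHolds φ s (C₁ * C₂) := by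
  classical
  intro p
  let r : ∀ j, Gj j ⧸ V.map (φ j) → Gj j → ℝ≥0∞ := fun j w y =>
    if (y : Gj j ⧸ V.map (φ j)) = w then p j y else 0
  let ψ : ∀ j, G ⧸ V →+ Gj j ⧸ V.map (φ j) := fun j =>
    QuotientAddGroup.map V (V.map (φ j)) (φ j) (AddSubgroup.le_comap_map _ _)
  have hr : ∀ j, ∑' w, ∑' y, r j w y = ∑' y, p j y := by
    intro j
    rw [ENNReal.tsum_comm]
    exact tsum_congr fun y => by simp [r]
  have hfib : ∀ q : G ⧸ V, ∑' v : V, ∏ j, p j (φ j (q.out + v)) ^ s j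
      ≤ C₁ * ∏ j, (∑' y, r j (ψ j q) y) ^ s j := by
    intro q
    have := h₁ fun j y => r j (ψ j q) (φ j q.out + y)
    refine le_trans (le_of_eq ?_) (this.trans (le_of_eq ?_))
    · refine tsum_congr fun v => Finset.prod_congr rfl fun j _ => ?_
      have : ((φ j q.out + φ j v : Gj j) : Gj j ⧸ V.map (φ j)) = ψ j q := by
        conv_rhs => rw [← QuotientAddGroup.out_eq' q]
        rw [QuotientAddGroup.map_mk, eq_comm, QuotientAddGroup.eq]
        exact ⟨v, v.2, by simp⟩
      simp [r, this]
    · congr 1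
      refine Finset.prod_congr rfl fun j _ => ?_
      congr 1
      exact (Equiv.addLeft (φ j q.out)).tsum_eq (r j (ψ j q))
  calc ∑' x : G, ∏ j, p j (φ j x) ^ s j
      = ∑' q : G ⧸ V, ∑' v : V, ∏ j, p j (φ j (q.out + v)) ^ s j := by
        have hbij : Function.Bijective fun a : (G ⧸ V) × V => a.1.out + (a.2 : G) := by
          constructor
          · rintro ⟨q, v⟩ ⟨q', v'⟩ h
            have hmk : ∀ (q : G ⧸ V) (v : V), ((q.out + v : G) : G ⧸ V) = q := by simp
            obtain rfl : q = q' := by rw [← hmk q v, ← hmk q' v']; exact congrArg _ h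
            simpa using h
          · refine fun x => ⟨((x : G ⧸ V), ⟨-(x : G ⧸ V).out + x, ?_⟩), by simp⟩
            rw [← QuotientAddGroup.eq, QuotientAddGroup.out_eq']
        rw [← ENNReal.tsum_prod]
        exact ((Equiv.ofBijective _ hbij).tsum_eq fun x => ∏ j, p j (φ j x) ^ s j).symm
    _ ≤ ∑' q : G ⧸ V, C₁ * ∏ j, (∑' y, r j (ψ j q) y) ^ s j := ENNReal.tsum_le_tsum hfib
    _ = C₁ * ∑' q : G ⧸ V, ∏ j, (∑' y, r j (ψ j q) y) ^ s j := ENNReal.tsum_mul_left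
    _ ≤ C₁ * (C₂ * ∏ j, (∑' w, ∑' y, r j w y) ^ s j) := by
        gcongr
        exact h₂ fun j w => ∑' y, r j w y
    _ = C₁ * C₂ * ∏ j, (∑' y, p j y) ^ s j := by simp only [hr, mul_assoc]

theorem HBLHolds.of_fg (h : ∀ V : AddSubgroup G, V.FG →
    HBLHolds (fun j => (φ j).comp V.subtype) s C) : HBLHolds φ s C := by
  intro p
  rw [ENNReal.tsum_eq_iSup_sum]
  refine iSup_le fun E => ?_
  let V := AddSubgroup.closure (E : Set G)
  refine le_trans ?_ (h V ⟨E, rfl⟩ p)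
  let e : E → V := fun x => ⟨x, AddSubgroup.subset_closure x.2⟩
  have he : Function.Injective e := fun x y hxy => by
    exact Subtype.ext (congrArg (fun v : V => (v : G)) hxy)
  rw [← Finset.tsum_subtype]
  exact ENNReal.tsum_comp_le_tsum_of_injective he
    fun v : V => ∏ j, p j (((φ j).comp V.subtype) v) ^ s j

theorem HBLHolds.of_rangeRestrict (hs : ∀ j, 0 ≤ s j)
    (h : HBLHolds (fun j => (φ j).rangeRestrict) s C) : HBLHolds φ s C := by
  intro p
  refine (h fun j y => p j y).trans ?_
  gcongr with j
  · exact hs j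
  · exact ENNReal.tsum_comp_le_tsum_of_injective Subtype.val_injective (p j)

/-- To prove a Hölder–Brascamp–Lieb inequality it suffices to consider finitely supported
probability densities that do not vanish on the relevant finite set. -/
theorem HBLHolds.of_density (hs : ∀ j, 0 ≤ s j) (hC : C ≠ 0)
    (h : ∀ (E : Finset G) (p : ∀ j, Gj j → ℝ), (∀ j, ∀ x ∈ E, 0 < p j (φ j x)) →
      (∀ j y, y ∉ φ j '' E → p j y = 0) → (∀ j, HasSum (p j) 1) →
      ENNReal.ofReal (∑ x ∈ E, ∏ j, p j (φ j x) ^ s j) ≤ C) : HBLHolds φ s C := by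
  classical
  intro p
  rw [ENNReal.tsum_eq_iSup_sum]
  refine iSup_le fun E₀ => ?_
  set E := E₀.filter fun x => ∏ j, p j (φ j x) ^ s j ≠ 0 with hE
  rw [← Finset.sum_filter_ne_zero, ← hE]
  rcases E.eq_empty_or_nonempty with h0 | ⟨x₀, hx₀⟩
  · simp [h0]
  have hpos : ∀ j, s j ≠ 0 → ∀ x ∈ E, p j (φ j x) ≠ 0 := by
    intro j hj x hx h0
    refine (Finset.mem_filter.1 hx).2 (Finset.prod_eq_zero (Finset.mem_univ j) ?_)
    rw [h0, ENNReal.zero_rpow_of_pos ((hs j).lt_of_ne' hj)]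
  let q : ∀ j, Gj j → ℝ≥0∞ := fun j y =>
    if y ∈ E.image (φ j) then (if s j = 0 then 1 else p j y) else 0
  let Q : Fin m → ℝ≥0∞ := fun j => ∑ y ∈ E.image (φ j), q j y
  have hq0 : ∀ j, ∀ x ∈ E, q j (φ j x) ≠ 0 := by
    intro j x hx
    have : φ j x ∈ E.image (φ j) := Finset.mem_image_of_mem _ hx
    by_cases h0 : s j = 0
    · simp only [q, this, h0, if_true, ne_eq, one_ne_zero, not_false_eq_true]
    · simpa only [q, this, h0, if_true, if_false] using hpos j h0 x hx
  have hqp : ∀ j, ∀ x ∈ E, q j (φ j x) ^ s j = p j (φ j x) ^ s j := by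
    intro j x hx
    have : φ j x ∈ E.image (φ j) := Finset.mem_image_of_mem _ hx
    by_cases h0 : s j = 0
    · simp [h0]
    · simp only [q, this, h0, if_true, if_false]
  have hQ0 : ∀ j, Q j ≠ 0 := fun j hj => hq0 j x₀ hx₀
    (Finset.sum_eq_zero_iff.1 hj _ (Finset.mem_image_of_mem _ hx₀))
  have hQP : ∀ j, Q j ^ s j ≤ (∑' y, p j y) ^ s j := by
    intro j
    by_cases h0 : s j = 0
    · simp [h0]
    · refine ENNReal.rpow_le_rpow ?_ (hs j)
      refine le_trans (Finset.sum_le_sum fun y hy => ?_) (ENNReal.sum_le_tsum (E.image (φ j)))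
      simp only [q, hy, h0, if_true, if_false, le_refl]
  refine le_trans ?_ (mul_le_mul_right (Finset.prod_le_prod' fun j _ => hQP j) C)
  by_cases htop : ∃ j, Q j = ⊤
  · obtain ⟨j, hj⟩ := htop
    have hj0 : s j ≠ 0 := by
      intro h0
      refine ENNReal.sum_ne_top.2 (fun y hy => ?_) hj
      simp only [q, hy, h0, if_true]
      exact ENNReal.one_ne_top
    have hsp := (hs j).lt_of_ne' hj0
    have : ∏ j, Q j ^ s j = ⊤ := by
      rw [← Finset.mul_prod_erase _ _ (Finset.mem_univ j), hj, ENNReal.top_rpow_of_pos hsp]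
      refine ENNReal.top_mul ?_
      refine Finset.prod_ne_zero_iff.2 fun i _ hi => ?_
      rcases ENNReal.rpow_eq_zero_iff.1 hi with h | h
      · exact hQ0 i h.1
      · exact absurd (hs i) (not_le.2 h.2)
    rw [this, ENNReal.mul_top hC]
    exact le_top
  push Not at htop
  have hqt : ∀ j y, q j y ≠ ⊤ := by
    intro j y
    by_cases hy : y ∈ E.image (φ j)
    · exact ne_top_of_le_ne_top (htop j) (Finset.single_le_sum (f := q j) (by simp) hy)
    · simp only [q, hy, if_false]; exact ENNReal.zero_ne_top
  let P : ∀ j, Gj j → ℝ := fun j y => (q j y / Q j).toReal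
  have hPt : ∀ j y, q j y / Q j ≠ ⊤ := fun j y => ENNReal.div_ne_top (hqt j y) (hQ0 j)
  have hPz : ∀ j y, y ∉ E.image (φ j) → P j y = 0 := by
    intro j y hy
    simp only [P, q, hy, if_false, ENNReal.zero_div, ENNReal.toReal_zero]
  have hPp : ∀ j, ∀ x ∈ E, 0 < P j (φ j x) := fun j x hx =>
    ENNReal.toReal_pos (ENNReal.div_pos (hq0 j x hx) (htop j)).ne' (hPt j _)
  have hP := h E P hPp (fun j y hy => hPz j y (by simpa using hy)) (by
      intro j
      have : ∑ y ∈ E.image (φ j), P j y = 1 := by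
        simp only [P]
        rw [← ENNReal.toReal_sum fun y _ => hPt j y]
        simp only [div_eq_mul_inv, ← Finset.sum_mul]
        rw [ENNReal.mul_inv_cancel (hQ0 j) (htop j), ENNReal.toReal_one]
      rw [← this]
      exact hasSum_sum_of_ne_finset_zero fun y hy => hPz j y hy)
  calc ∑ x ∈ E, ∏ j, p j (φ j x) ^ s j
      = ∑ x ∈ E, (∏ j, ENNReal.ofReal (P j (φ j x) ^ s j)) * ∏ j, Q j ^ s j := by
        refine Finset.sum_congr rfl fun x hx => ?_
        rw [← Finset.prod_mul_distrib]
        refine Finset.prod_congr rfl fun j _ => ?_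
        rw [← ENNReal.ofReal_rpow_of_pos (hPp j x hx), ENNReal.ofReal_toReal (hPt j _),
          ← ENNReal.mul_rpow_of_nonneg _ _ (hs j), ENNReal.div_mul_cancel (hQ0 j) (htop j),
          hqp j x hx]
    _ = ENNReal.ofReal (∑ x ∈ E, ∏ j, P j (φ j x) ^ s j) * ∏ j, Q j ^ s j := by
        rw [← Finset.sum_mul, ENNReal.ofReal_sum_of_nonneg fun x _ =>
          Finset.prod_nonneg fun j _ => Real.rpow_nonneg ENNReal.toReal_nonneg _]
        congr 1
        refine Finset.sum_congr rfl fun x _ => ?_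
        rw [ENNReal.ofReal_prod_of_nonneg fun j _ => Real.rpow_nonneg ENNReal.toReal_nonneg _]
    _ ≤ C * ∏ j, Q j ^ s j := by gcongr

end

theorem one_le_HBLA {G : Type*} [AddCommGroup G] {m : ℕ} {Gj : Fin m → Type*}
    [∀ j, AddCommGroup (Gj j)] (φ : ∀ j, G →+ Gj j) (s : Fin m → ℝ) : 1 ≤ HBLA φ s := by
  refine le_trans ?_ (le_iSup₂ (⊥ : AddSubgroup G) (by simp))
  simp [HBLAloc, AddSubgroup.map_bot]

section

variable {A : Type*} [AddCommGroup A] [Fintype A]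

theorem sum_autocorrelation (p : A → ℝ) :
    ∑ w, ∑ y, p y * p (y + w) = (∑ y, p y) ^ 2 := by
  rw [Finset.sum_comm, sq, Finset.sum_mul]
  refine Finset.sum_congr rfl fun y _ => ?_
  rw [← Finset.mul_sum]
  congr 1
  exact Equiv.sum_comp (Equiv.addLeft y) p

theorem sum_sq_sub_sum_sq_autocorrelation (p : A → ℝ) (hp : ∑ y, p y = 1) :
    2 * (∑ w, p w ^ 2 - ∑ w, (∑ y, p y * p (y + w)) ^ 2)
      = ∑ y, ∑ z, p y * p z * ∑ w, (p (y + w) - p (z + w)) ^ 2 := by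
  have h1 : ∀ y z, ∑ w, (p (y + w) - p (z + w)) ^ 2
      = 2 * ∑ w, p w ^ 2 - 2 * ∑ w, p (y + w) * p (z + w) := by
    intro y z
    have hy : ∑ w, p (y + w) ^ 2 = ∑ w, p w ^ 2 :=
      Equiv.sum_comp (Equiv.addLeft y) fun w => p w ^ 2
    have hz : ∑ w, p (z + w) ^ 2 = ∑ w, p w ^ 2 :=
      Equiv.sum_comp (Equiv.addLeft z) fun w => p w ^ 2
    rw [two_mul]
    nth_rw 1 [← hy]
    rw [← hz, Finset.mul_sum, ← Finset.sum_add_distrib, ← Finset.sum_sub_distrib]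
    exact Finset.sum_congr rfl fun w _ => by ring
  have h2 : ∑ w, (∑ y, p y * p (y + w)) ^ 2
      = ∑ y, ∑ z, p y * p z * ∑ w, p (y + w) * p (z + w) := by
    simp only [sq, Finset.sum_mul_sum]
    simp only [Finset.mul_sum]
    rw [Finset.sum_comm]
    refine Finset.sum_congr rfl fun y _ => ?_
    rw [Finset.sum_comm]
    exact Finset.sum_congr rfl fun z _ => Finset.sum_congr rfl fun w _ => by ring
  have h3 : ∀ y z, p y * p z * (2 * ∑ w, p w ^ 2 - 2 * ∑ w, p (y + w) * p (z + w))
      = p y * p z * (2 * ∑ w, p w ^ 2) - 2 * (p y * p z * ∑ w, p (y + w) * p (z + w)) :=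
    fun y z => by ring
  simp only [h1, h2, h3, Finset.sum_sub_distrib]
  simp only [← Finset.sum_mul, ← Finset.mul_sum, hp]
  ring

theorem sum_sq_autocorrelation_le {p : A → ℝ} (hp0 : ∀ y, 0 ≤ p y) (hp : ∑ y, p y = 1) :
    ∑ w, (∑ y, p y * p (y + w)) ^ 2 ≤ ∑ w, p w ^ 2 := by
  have h := sum_sq_sub_sum_sq_autocorrelation p hp
  have : 0 ≤ ∑ y, ∑ z, p y * p z * ∑ w, (p (y + w) - p (z + w)) ^ 2 :=
    Finset.sum_nonneg fun y _ => Finset.sum_nonneg fun z _ =>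
      mul_nonneg (mul_nonneg (hp0 y) (hp0 z)) (Finset.sum_nonneg fun w _ => sq_nonneg _)
  linarith

/-- A probability density whose autocorrelation has the same `ℓ²` norm is the uniform density
on a coset of a subgroup. -/
theorem eq_uniform_of_sum_sq_autocorrelation_ge {p : A → ℝ} (hp0 : ∀ y, 0 ≤ p y)
    (hp : ∑ y, p y = 1) (h : ∑ w, p w ^ 2 ≤ ∑ w, (∑ y, p y * p (y + w)) ^ 2) :
    ∃ (a : A) (L : AddSubgroup A), (∀ y, y - a ∈ L → p y = (Nat.card L : ℝ)⁻¹) ∧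
      ∀ y, y - a ∉ L → p y = 0 := by
  classical
  have hzero : ∑ y, ∑ z, p y * p z * ∑ w, (p (y + w) - p (z + w)) ^ 2 = 0 := by
    rw [← sum_sq_sub_sum_sq_autocorrelation p hp]
    linarith [sum_sq_autocorrelation_le hp0 hp]
  have hnn : ∀ y z, 0 ≤ p y * p z * ∑ w, (p (y + w) - p (z + w)) ^ 2 := fun y z =>
    mul_nonneg (mul_nonneg (hp0 y) (hp0 z)) (Finset.sum_nonneg fun w _ => sq_nonneg _)
  have htrans : ∀ y z, p y ≠ 0 → p z ≠ 0 → ∀ w, p (y + w) = p (z + w) := by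
    intro y z hy hz w
    have h1 := (Finset.sum_eq_zero_iff_of_nonneg fun y _ =>
      Finset.sum_nonneg fun z _ => hnn y z).1 hzero y (Finset.mem_univ _)
    have h2 := (Finset.sum_eq_zero_iff_of_nonneg fun z _ => hnn y z).1 h1 z (Finset.mem_univ _)
    have h3 := (mul_eq_zero.1 h2).resolve_left (mul_ne_zero hy hz)
    have h4 := (Finset.sum_eq_zero_iff_of_nonneg fun w _ => sq_nonneg _).1 h3 w
      (Finset.mem_univ _)
    exact sub_eq_zero.1 (pow_eq_zero_iff two_ne_zero |>.1 h4)
  obtain ⟨a, ha⟩ : ∃ a, p a ≠ 0 := by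
    by_contra! h0
    simp [h0] at hp
  let L : AddSubgroup A :=
    { carrier := {t | ∀ u, p (t + u) = p u}
      zero_mem' := fun u => by rw [zero_add]
      add_mem' := fun {t t'} ht ht' u => by rw [add_assoc, ht, ht']
      neg_mem' := fun {t} ht u => by rw [← ht, add_neg_cancel_left] }
  have hL1 : ∀ y, y - a ∈ L → p y = p a := fun y hy => by
    simpa using hy a
  have hL2 : ∀ y, y - a ∉ L → p y = 0 := by
    intro y hy
    by_contra h0
    refine hy fun u => ?_
    have := htrans y a h0 ha (u - a)
    rwa [add_sub_cancel, add_sub, add_sub_right_comm] at this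
  have hcard : (Nat.card L : ℝ) * p a = 1 := by
    rw [← hp, ← Equiv.sum_comp (Equiv.addRight a) p, ← Finset.sum_filter_add_sum_filter_not
      Finset.univ (· ∈ L), Finset.sum_eq_zero (s := Finset.univ.filter (· ∉ L)), add_zero,
      Finset.sum_congr rfl (g := fun _ => p a), Finset.sum_const, nsmul_eq_mul,
      Nat.card_eq_fintype_card, Fintype.card_subtype]
    · intro y hy
      exact hL1 _ (by simpa using hy)
    · intro y hy
      exact hL2 _ (by simpa using hy)
  exact ⟨a, L, fun y hy => by rw [hL1 y hy]; exact eq_inv_of_mul_eq_one_right hcard, hL2⟩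

end

section

variable {G : Type*} [AddCommGroup G] [Fintype G] {m : ℕ} {Gj : Fin m → Type*}
  [∀ j, AddCommGroup (Gj j)] [∀ j, Fintype (Gj j)] {φ : ∀ j, G →+ Gj j} {s : Fin m → ℝ}

theorem sum_prod_rpow_le_of_stdSimplex {B : ℝ} (hB0 : 0 ≤ B)
    (hB : ∀ p ∈ Set.univ.pi fun j => stdSimplex ℝ (Gj j),
      ∑ x, ∏ j, p j (φ j x) ^ s j ≤ B)
    {q : ∀ j, Gj j → ℝ} (hq : ∀ j y, 0 ≤ q j y) :
    ∑ x, ∏ j, q j (φ j x) ^ s j ≤ B * ∏ j, (∑ y, q j y) ^ s j := by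
  classical
  have hQ : ∀ j, 0 ≤ ∑ y, q j y := fun j => Finset.sum_nonneg fun y _ => hq j y
  by_cases h0 : ∃ j, s j ≠ 0 ∧ ∑ y, q j y = 0
  · obtain ⟨j, hj, hj0⟩ := h0
    have hqz := (Finset.sum_eq_zero_iff_of_nonneg fun y _ => hq j y).1 hj0
    rw [Finset.sum_eq_zero]
    · exact mul_nonneg hB0 (Finset.prod_nonneg fun j _ => Real.rpow_nonneg (hQ j) _)
    · exact fun x _ => Finset.prod_eq_zero (Finset.mem_univ j)
        (by rw [hqz _ (Finset.mem_univ _), Real.zero_rpow hj])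
  push Not at h0
  let p : ∀ j, Gj j → ℝ := fun j =>
    if ∑ y, q j y = 0 then Pi.single 0 1 else fun y => q j y / ∑ y, q j y
  have hp : p ∈ Set.univ.pi fun j => stdSimplex ℝ (Gj j) := by
    intro j _
    by_cases hj : ∑ y, q j y = 0
    · simp only [p, hj, if_true]
      exact single_mem_stdSimplex ℝ 0
    · simp only [p, hj, if_false]
      exact ⟨fun y => div_nonneg (hq j y) (hQ j), by rw [← Finset.sum_div, div_self hj]⟩
  have hqp : ∀ j y, q j y ^ s j = p j y ^ s j * (∑ y, q j y) ^ s j := by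
    intro j y
    by_cases hj : s j = 0
    · simp [hj]
    · have := h0 j hj
      simp only [p, this, if_false]
      rw [← Real.mul_rpow (div_nonneg (hq j y) (hQ j)) (hQ j), div_mul_cancel₀ _ this]
  simp only [hqp, Finset.prod_mul_distrib, ← Finset.sum_mul]
  exact mul_le_mul_of_nonneg_right (hB p hp)
    (Finset.prod_nonneg fun j _ => Real.rpow_nonneg (hQ j) _)

/-- On finite groups the maximum of the normalized functional is attained by uniform densities
on cosets of subgroups. -/
theorem exists_uniform_isMaxOn (hs : ∀ j, 0 ≤ s j) :
    ∃ p ∈ Set.univ.pi fun j => stdSimplex ℝ (Gj j),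
      (∀ q ∈ Set.univ.pi fun j => stdSimplex ℝ (Gj j),
        ∑ x, ∏ j, q j (φ j x) ^ s j ≤ ∑ x, ∏ j, p j (φ j x) ^ s j) ∧
      ∀ j, ∃ (a : Gj j) (L : AddSubgroup (Gj j)),
        (∀ y, y - a ∈ L → p j y = (Nat.card L : ℝ)⁻¹) ∧ ∀ y, y - a ∉ L → p j y = 0 := by
  classical
  set Δ : Set (∀ j, Gj j → ℝ) := Set.univ.pi fun j => stdSimplex ℝ (Gj j) with hΔ
  have hΔc : IsCompact Δ := isCompact_univ_pi fun j => isCompact_stdSimplex ℝ (Gj j)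
  have hΔn : Δ.Nonempty := ⟨fun j => Pi.single 0 1, fun j _ => single_mem_stdSimplex ℝ 0⟩
  set Ψ : (∀ j, Gj j → ℝ) → ℝ := fun p => ∑ x, ∏ j, p j (φ j x) ^ s j with hΨ
  have hΨc : Continuous Ψ := by
    refine continuous_finsetSum _ fun x _ => continuous_finsetProd _ fun j _ => ?_
    exact Continuous.rpow_const (by fun_prop) fun _ => Or.inr (hs j)
  obtain ⟨p₀, hp₀, hmax⟩ := hΔc.exists_isMaxOn hΔn hΨc.continuousOn
  have hMc : IsCompact (Δ ∩ {p | Ψ p₀ ≤ Ψ p}) :=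
    hΔc.inter_right (isClosed_le continuous_const hΨc)
  obtain ⟨p, ⟨hp, hpM⟩, hmin⟩ := hMc.exists_isMinOn ⟨p₀, hp₀, le_refl (Ψ p₀)⟩
    (f := fun p => ∑ j, ∑ y, p j y ^ 2) (by fun_prop)
  have hpmax : ∀ q ∈ Δ, Ψ q ≤ Ψ p := fun q hq => (hmax hq).trans hpM
  have hp0 : ∀ j y, 0 ≤ p j y := fun j y => (hp j (Set.mem_univ j)).1 y
  have hp1 : ∀ j, ∑ y, p j y = 1 := fun j => (hp j (Set.mem_univ j)).2
  have hΨpos : 0 < Ψ p := by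
    have hu : (fun j (_ : Gj j) => (Fintype.card (Gj j) : ℝ)⁻¹) ∈ Δ := fun j _ =>
      ⟨fun _ => by positivity, by simp⟩
    refine lt_of_lt_of_le ?_ (hpmax _ hu)
    exact Finset.sum_pos (fun x _ => Finset.prod_pos fun j _ =>
      Real.rpow_pos_of_pos (inv_pos.2 (Nat.cast_pos.2 Fintype.card_pos)) _) Finset.univ_nonempty
  let k : ∀ j, Gj j → ℝ := fun j w => ∑ y, p j y * p j (y + w)
  have hk : k ∈ Δ := fun j _ => ⟨fun w => Finset.sum_nonneg fun y _ =>
    mul_nonneg (hp0 j _) (hp0 j _), by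
      change ∑ w, ∑ y, p j y * p j (y + w) = 1
      rw [sum_autocorrelation, hp1, one_pow]⟩
  have hΨk : Ψ p ≤ Ψ k := by
    refine le_of_mul_le_mul_left ?_ hΨpos
    calc Ψ p * Ψ p = ∑ z, ∑ x, ∏ j, (p j (φ j x) * p j (φ j x + φ j z)) ^ s j := by
          rw [Finset.sum_comm, hΨ, Finset.sum_mul]
          refine Finset.sum_congr rfl fun x _ => ?_
          beta_reduce
          rw [← Equiv.sum_comp (Equiv.addLeft x) fun z => ∏ j, p j (φ j z) ^ s j, Finset.mul_sum]
          refine Finset.sum_congr rfl fun z _ => ?_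
          rw [← Finset.prod_mul_distrib]
          refine Finset.prod_congr rfl fun j _ => ?_
          rw [Real.mul_rpow (hp0 j _) (hp0 j _)]
          simp
      _ ≤ ∑ z, Ψ p * ∏ j, k j (φ j z) ^ s j := by
          refine Finset.sum_le_sum fun z _ => ?_
          exact sum_prod_rpow_le_of_stdSimplex hΨpos.le hpmax
            (q := fun j y => p j y * p j (y + φ j z))
            fun j y => mul_nonneg (hp0 j _) (hp0 j _)
      _ = Ψ p * Ψ k := by rw [← Finset.mul_sum]
  have hQ : ∑ j, ∑ y, p j y ^ 2 ≤ ∑ j, ∑ y, k j y ^ 2 := hmin ⟨hk, hpM.trans hΨk⟩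
  have hle : ∀ j ∈ Finset.univ, ∑ y, k j y ^ 2 ≤ ∑ y, p j y ^ 2 := fun j _ =>
    sum_sq_autocorrelation_le (hp0 j) (hp1 j)
  have heq := (Finset.sum_eq_sum_iff_of_le hle).1 (le_antisymm (Finset.sum_le_sum hle) hQ)
  exact ⟨p, hp, hpmax, fun j => eq_uniform_of_sum_sq_autocorrelation_ge (hp0 j) (hp1 j)
    (heq j (Finset.mem_univ j)).ge⟩

theorem ofReal_sum_prod_uniform_le_HBLA (hs : ∀ j, 0 ≤ s j) {p : ∀ j, Gj j → ℝ}
    (a : ∀ j, Gj j) (L : ∀ j, AddSubgroup (Gj j))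
    (h1 : ∀ j y, y - a j ∈ L j → p j y = (Nat.card (L j) : ℝ)⁻¹)
    (h0 : ∀ j y, y - a j ∉ L j → p j y = 0) :
    ENNReal.ofReal (∑ x, ∏ j, p j (φ j x) ^ s j) ≤ HBLA φ s := by
  classical
  let H : AddSubgroup G := ⨅ j, ⨅ _ : s j ≠ 0, (L j).comap (φ j)
  have hmem : ∀ x, x ∈ H ↔ ∀ j, s j ≠ 0 → φ j x ∈ L j := by
    simp [H, AddSubgroup.mem_iInf]
  set S := Finset.univ.filter fun x => ∀ j, s j ≠ 0 → φ j x - a j ∈ L j with hS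
  have hsum : ∑ x, ∏ j, p j (φ j x) ^ s j = S.card * ∏ j, ((Nat.card (L j) : ℝ)⁻¹) ^ s j := by
    rw [← nsmul_eq_mul, ← Finset.sum_const, hS, Finset.sum_filter]
    refine Finset.sum_congr rfl fun x _ => ?_
    split_ifs with hx
    · refine Finset.prod_congr rfl fun j _ => ?_
      by_cases hj : s j = 0
      · simp [hj]
      · rw [h1 j _ (hx j hj)]
    · push Not at hx
      obtain ⟨j, hj, hx⟩ := hx
      exact Finset.prod_eq_zero (Finset.mem_univ j) (by rw [h0 j _ hx, Real.zero_rpow hj])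
  have hcard : S.card ≤ Nat.card H := by
    rcases S.eq_empty_or_nonempty with he | ⟨x₀, hx₀⟩
    · simp [he]
    · rw [Nat.card_eq_fintype_card, Fintype.card_subtype]
      refine Finset.card_le_card_of_injOn (fun x => x - x₀) (fun x hx => ?_)
        fun x _ y _ h => sub_left_injective h
      simp only [hS, Finset.coe_filter, Finset.mem_filter, Finset.mem_univ, true_and,
        Set.mem_ofPred_eq, hmem] at hx hx₀ ⊢
      intro j hj
      have := (L j).sub_mem (hx j hj) (hx₀ j hj)
      rwa [sub_sub_sub_cancel_right, ← map_sub] at this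
  refine le_trans ?_ (le_iSup₂ H (Set.toFinite _))
  rw [hsum, ENNReal.ofReal_mul (Nat.cast_nonneg _), ENNReal.ofReal_natCast,
    ENNReal.ofReal_prod_of_nonneg fun j _ => by positivity]
  refine mul_le_mul' (by exact_mod_cast hcard) (Finset.prod_le_prod' fun j _ => ?_)
  have hLpos : 0 < (Nat.card (L j) : ℝ) := Nat.cast_pos.2 Nat.card_pos
  rw [← ENNReal.ofReal_rpow_of_pos (inv_pos.2 hLpos), ENNReal.ofReal_inv_of_pos hLpos,
    ENNReal.ofReal_natCast, ENNReal.rpow_neg, ENNReal.inv_rpow]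
  by_cases hj : s j = 0
  · simp [hj]
  refine ENNReal.inv_le_inv.2 (ENNReal.rpow_le_rpow ?_ (hs j))
  have hle : H.map (φ j) ≤ L j := by
    rintro _ ⟨x, hx, rfl⟩
    exact (hmem x).1 hx j hj
  exact_mod_cast Nat.card_mono (Set.toFinite _) hle

theorem HBLHolds.of_fintype (hs : ∀ j, 0 ≤ s j) : HBLHolds φ s (HBLA φ s) := by
  classical
  obtain ⟨p, -, hmax, hp⟩ := exists_uniform_isMaxOn (φ := φ) hs
  choose a L h1 h0 using hp
  refine HBLHolds.of_density hs (zero_lt_one.trans_le (one_le_HBLA φ s)).ne' ?_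
  intro E q hqp hqz hq1
  have hq0 : ∀ j y, 0 ≤ q j y := by
    intro j y
    by_cases hy : y ∈ φ j '' E
    · obtain ⟨x, hx, rfl⟩ := hy
      exact (hqp j x hx).le
    · exact (hqz j y hy).ge
  refine le_trans (ENNReal.ofReal_le_ofReal ?_) (ofReal_sum_prod_uniform_le_HBLA hs a L h1 h0)
  refine le_trans (Finset.sum_le_univ_sum_of_nonneg fun x => ?_)
    (hmax q fun j _ => ⟨hq0 j, (hasSum_fintype (q j)).unique (hq1 j)⟩)
  exact Finset.prod_nonneg fun j _ => Real.rpow_nonneg (hq0 j _) _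

end

section

variable {G : Type*} [AddCommGroup G] {m : ℕ} {Gj : Fin m → Type*}
  [∀ j, AddCommGroup (Gj j)] (φ : ∀ j, G →+ Gj j) {s : Fin m → ℝ}

theorem HBLA_rangeRestrict : HBLA (fun j => (φ j).rangeRestrict) s = HBLA φ s := by
  have : ∀ (H : AddSubgroup G) j,
      Nat.card (H.map (φ j).rangeRestrict) = Nat.card (H.map (φ j)) := fun H j => by
    rw [← AddMonoidHom.subtype_comp_rangeRestrict (φ j), ← AddSubgroup.map_map]
    exact (AddSubgroup.card_map_of_injective (AddSubgroup.subtype_injective _)).symm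
  simp only [HBLA, HBLAloc, this]

theorem HBLA_comp_subtype_le (V : AddSubgroup G) :
    HBLA (fun j => (φ j).comp V.subtype) s ≤ HBLA φ s := by
  refine iSup₂_le fun H hH => le_trans (le_of_eq ?_)
    (le_iSup₂ (H.map V.subtype) (by simpa using hH.image _))
  simp only [HBLAloc, AddSubgroup.map_map]
  rw [AddSubgroup.card_map_of_injective V.subtype_injective]

theorem HBLHolds.of_finite [Finite G] (hs : ∀ j, 0 ≤ s j) : HBLHolds φ s (HBLA φ s) := by
  have := Fintype.ofFinite G
  have := fun j => Finite.of_surjective _ (φ j).rangeRestrict_surjective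
  have := fun j => Fintype.ofFinite (φ j).range
  rw [← HBLA_rangeRestrict]
  exact HBLHolds.of_rangeRestrict hs (HBLHolds.of_fintype hs)

end

section

open Module Cardinal

theorem rank_map_lt_aleph0 {A B : Type*} [AddCommGroup A] [AddCommGroup B] (f : A →+ B)
    (H : AddSubgroup A) (hH : Module.rank ℤ H < ℵ₀) : Module.rank ℤ (H.map f) < ℵ₀ := by
  have h := LinearMap.lift_rank_le_of_surjective (f.addSubgroupMap H).toIntLinearMap
    (f.addSubgroupMap_surjective H)
  exact lift_lt_aleph0.1 (h.trans_lt (lift_lt_aleph0.2 hH))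

theorem finrank_map_le {A B : Type*} [AddCommGroup A] [AddCommGroup B] (f : A →+ B)
    (H : AddSubgroup A) (hH : Module.rank ℤ H < ℵ₀) : finrank ℤ (H.map f) ≤ finrank ℤ H := by
  have h := LinearMap.lift_rank_le_of_surjective (f.addSubgroupMap H).toIntLinearMap
    (f.addSubgroupMap_surjective H)
  exact finrank_le_finrank_of_rank_le_rank h hH

theorem rank_addSubgroup_lt_aleph0 {A : Type*} [AddCommGroup A] (hA : Module.rank ℤ A < ℵ₀)
    (H : AddSubgroup A) : Module.rank ℤ H < ℵ₀ :=
  (LinearMap.rank_le_of_injective H.subtype.toIntLinearMap H.subtype_injective).trans_lt hA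

theorem rank_quotient_lt_aleph0 {A : Type*} [AddCommGroup A] (hA : Module.rank ℤ A < ℵ₀)
    (H : AddSubgroup A) : Module.rank ℤ (A ⧸ H) < ℵ₀ :=
  (LinearMap.rank_le_of_surjective (QuotientAddGroup.mk' H).toIntLinearMap
    (QuotientAddGroup.mk'_surjective H)).trans_lt hA

theorem finrank_addSubgroup_congr {A B : Type*} [AddCommGroup A] [AddCommGroup B]
    {H : AddSubgroup A} {K : AddSubgroup B} (e : H ≃+ K) : finrank ℤ H = finrank ℤ K :=
  e.toIntLinearEquiv.finrank_eq

theorem finrank_map_mk_add_finrank {B : Type*} [AddCommGroup B] {N M : AddSubgroup B}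
    (hNM : N ≤ M) (hM : Module.rank ℤ M < ℵ₀) :
    finrank ℤ (M.map (QuotientAddGroup.mk' N)) + finrank ℤ N = finrank ℤ M := by
  let f : M →ₗ[ℤ] M.map (QuotientAddGroup.mk' N) :=
    ((QuotientAddGroup.mk' N).addSubgroupMap M).toIntLinearMap
  have hf : Function.Surjective f := (QuotientAddGroup.mk' N).addSubgroupMap_surjective M
  have hker : finrank ℤ (LinearMap.ker f) = finrank ℤ N := by
    refine LinearEquiv.finrank_eq (LinearEquiv.symm (AddEquiv.toIntLinearEquiv ?_))
    refine AddEquiv.ofBijective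
      (AddMonoidHom.mk' (fun x : N => (⟨⟨x, hNM x.2⟩, ?_⟩ : LinearMap.ker f)) ?_) ⟨?_, ?_⟩
    · exact LinearMap.mem_ker.2 (Subtype.ext ((QuotientAddGroup.eq_zero_iff _).2 x.2))
    · exact fun x y => rfl
    · exact fun x y h => Subtype.ext (congrArg (fun z : LinearMap.ker f => ((z : M) : B)) h)
    · rintro ⟨⟨x, hx⟩, hx'⟩
      exact ⟨⟨x, (QuotientAddGroup.eq_zero_iff _).1
        (congrArg Subtype.val (LinearMap.mem_ker.1 hx'))⟩, rfl⟩
  have h := LinearMap.rank_range_add_rank_ker f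
  rw [LinearMap.range_eq_top.2 hf, rank_top] at h
  have hk : Module.rank ℤ (LinearMap.ker f) < ℵ₀ := (Submodule.rank_le _).trans_lt hM
  rw [← hker]
  unfold finrank
  rw [← h, toNat_add (rank_map_lt_aleph0 _ _ hM) hk]

theorem finrank_eq_of_forall_exists_zsmul_mem {B : Type*} [AddCommGroup B]
    {N M : AddSubgroup B} (hNM : N ≤ M) (hM : Module.rank ℤ M < ℵ₀)
    (h : ∀ x ∈ M, ∃ n : ℤ, n ≠ 0 ∧ n • x ∈ N) : finrank ℤ M = finrank ℤ N := by
  have h0 : Module.rank ℤ (M.map (QuotientAddGroup.mk' N)) = 0 := by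
    refine rank_eq_zero_iff.2 ?_
    rintro ⟨_, x, hx, rfl⟩
    obtain ⟨n, hn, hnx⟩ := h x hx
    exact ⟨n, hn, Subtype.ext ((QuotientAddGroup.eq_zero_iff (n • x)).2 hnx)⟩
  rw [← finrank_map_mk_add_finrank hNM hM]
  unfold finrank
  rw [h0, map_zero, zero_add]

theorem exists_zsmul_mem_of_finrank_eq {A : Type*} [AddCommGroup A]
    (hA : Module.rank ℤ A < ℵ₀) {V : AddSubgroup A} (h : finrank ℤ V = finrank ℤ A) (x : A) :
    ∃ n : ℤ, n ≠ 0 ∧ n • x ∈ V := by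
  have htop : finrank ℤ (⊤ : AddSubgroup A) = finrank ℤ A :=
    AddSubgroup.topEquiv.toIntLinearEquiv.finrank_eq
  have h1 := finrank_map_mk_add_finrank (le_top : V ≤ ⊤) (rank_addSubgroup_lt_aleph0 hA _)
  have h2 : finrank ℤ ((⊤ : AddSubgroup A).map (QuotientAddGroup.mk' V)) = 0 := by omega
  have hlt := rank_map_lt_aleph0 (QuotientAddGroup.mk' V) ⊤ (rank_addSubgroup_lt_aleph0 hA _)
  have h3 := (toNat_eq_zero.1 h2).resolve_right (not_le.2 hlt)
  obtain ⟨n, hn, hx⟩ := rank_eq_zero_iff.1 h3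
    ⟨_, AddSubgroup.mem_map_of_mem _ (AddSubgroup.mem_top x)⟩
  exact ⟨n, hn, (QuotientAddGroup.eq_zero_iff (n • x)).1 (congrArg Subtype.val hx)⟩

theorem finrank_map_eq_of_forall_exists_zsmul_mem {A B : Type*} [AddCommGroup A]
    [AddCommGroup B] (f : A →+ B) {N M : AddSubgroup A} (hNM : N ≤ M)
    (hM : Module.rank ℤ M < ℵ₀) (h : ∀ x ∈ M, ∃ n : ℤ, n ≠ 0 ∧ n • x ∈ N) :
    finrank ℤ (M.map f) = finrank ℤ (N.map f) := by
  refine finrank_eq_of_forall_exists_zsmul_mem (AddSubgroup.map_mono hNM)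
    (rank_map_lt_aleph0 f M hM) ?_
  rintro _ ⟨x, hx, rfl⟩
  obtain ⟨n, hn, hnx⟩ := h x hx
  exact ⟨n, hn, n • x, hnx, map_zsmul f n x⟩

/-- The set of elements having a nonzero multiple in `V`. -/
def AddSubgroup.saturation {A : Type*} [AddCommGroup A] (V : AddSubgroup A) : AddSubgroup A where
  carrier := {x | ∃ n : ℤ, n ≠ 0 ∧ n • x ∈ V}
  zero_mem' := ⟨1, one_ne_zero, by simp⟩
  add_mem' := by
    rintro x y ⟨n, hn, hx⟩ ⟨k, hk, hy⟩
    refine ⟨n * k, mul_ne_zero hn hk, ?_⟩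
    rw [smul_add, mul_smul n k y, mul_comm, mul_smul]
    exact V.add_mem (V.zsmul_mem hx k) (V.zsmul_mem hy n)
  neg_mem' := by
    rintro x ⟨n, hn, hx⟩
    exact ⟨n, hn, by rw [smul_neg]; exact V.neg_mem hx⟩

theorem AddSubgroup.le_saturation {A : Type*} [AddCommGroup A] (V : AddSubgroup A) :
    V ≤ V.saturation :=
  fun x hx => ⟨1, one_ne_zero, by simpa using hx⟩

instance {A : Type*} [AddCommGroup A] (V : AddSubgroup A) :
    IsAddTorsionFree (A ⧸ V.saturation) := by
  refine .of_not_isOfFinAddOrder fun g hne hfin => hne ?_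
  obtain ⟨x, rfl⟩ := QuotientAddGroup.mk_surjective g
  obtain ⟨n, hn, hx⟩ := hfin.exists_nsmul_eq_zero
  obtain ⟨k, hk, hkx⟩ := (QuotientAddGroup.eq_zero_iff (n • x)).1 hx
  refine (QuotientAddGroup.eq_zero_iff x).2 ⟨k * n, mul_ne_zero hk (by omega), ?_⟩
  rwa [mul_smul, natCast_zsmul]

end

section

open Module Cardinal

variable {G : Type*} [AddCommGroup G] {m : ℕ} {Gj : Fin m → Type*}
  [∀ j, AddCommGroup (Gj j)] {φ : ∀ j, G →+ Gj j} {s : Fin m → ℝ}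

theorem HBLP.comp_subtype (h : HBLP φ s) (V : AddSubgroup G) :
    HBLP (fun j => (φ j).comp V.subtype) s := by
  refine ⟨h.1, fun H hH => ?_⟩
  have := h.2 (H.map V.subtype) (rank_map_lt_aleph0 _ _ hH)
  have h1 : finrank ℤ H = finrank ℤ (H.map V.subtype) :=
    finrank_addSubgroup_congr (H.equivMapOfInjective _ V.subtype_injective)
  have h2 : ∀ j, finrank ℤ (H.map ((φ j).comp V.subtype))
      = finrank ℤ ((H.map V.subtype).map (φ j)) := fun j => by rw [AddSubgroup.map_map]
  change (finrank ℤ H : ℝ) ≤ ∑ j, s j * (finrank ℤ (H.map ((φ j).comp V.subtype)) : ℝ)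
  simp only [h1, h2]
  exact this

theorem HBLP.quotient (h : HBLP φ s) (hG : Module.rank ℤ G < ℵ₀) (V : AddSubgroup G)
    (hV : (finrank ℤ V : ℝ) = ∑ j, s j * finrank ℤ (V.map (φ j))) :
    HBLP (fun j => QuotientAddGroup.map V (V.map (φ j)) (φ j)
      (AddSubgroup.le_comap_map _ _)) s := by
  refine ⟨h.1, fun W _ => ?_⟩
  set W' := W.comap (QuotientAddGroup.mk' V) with hW'
  have hVW : V ≤ W' := fun x hx => by
    change (x : G ⧸ V) ∈ W
    rw [(QuotientAddGroup.eq_zero_iff x).2 hx]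
    exact W.zero_mem
  have hWW : W'.map (QuotientAddGroup.mk' V) = W :=
    AddSubgroup.map_comap_eq_self_of_surjective (QuotientAddGroup.mk'_surjective V) W
  have hr := rank_addSubgroup_lt_aleph0 hG W'
  have h1 := finrank_map_mk_add_finrank hVW hr
  rw [hWW] at h1
  have h2 : ∀ j, finrank ℤ (W.map (QuotientAddGroup.map V (V.map (φ j)) (φ j)
      (AddSubgroup.le_comap_map _ _))) + finrank ℤ (V.map (φ j)) = finrank ℤ (W'.map (φ j)) := by
    intro j
    rw [← finrank_map_mk_add_finrank (AddSubgroup.map_mono hVW : V.map (φ j) ≤ W'.map (φ j))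
      (rank_map_lt_aleph0 _ _ hr)]
    have : W.map (QuotientAddGroup.map V (V.map (φ j)) (φ j) (AddSubgroup.le_comap_map _ _))
        = (W'.map (φ j)).map (QuotientAddGroup.mk' (V.map (φ j))) := by
      conv_lhs => rw [← hWW]
      rw [AddSubgroup.map_map, AddSubgroup.map_map]
      rfl
    rw [this]
  have h3 : (finrank ℤ W' : ℝ) ≤ ∑ j, s j * (finrank ℤ (W'.map (φ j)) : ℝ) := h.2 W' hr
  change (finrank ℤ W : ℝ) ≤ ∑ j, s j * (finrank ℤ (W.map _) : ℝ)
  simp only [← h1, ← h2, Nat.cast_add, mul_add, Finset.sum_add_distrib] at h3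
  linarith

theorem finrank_le_sum_of_HBLP (h : HBLP φ s) (hG : Module.rank ℤ G < ℵ₀) (V : AddSubgroup G) :
    (finrank ℤ V : ℝ) ≤ ∑ j, s j * finrank ℤ (V.map (φ j)) :=
  h.2 V (rank_addSubgroup_lt_aleph0 hG V)

theorem isCompact_setOf_HBLP : IsCompact {s | HBLP φ s} := by
  refine IsCompact.of_isClosed_subset
    (isCompact_univ_pi fun _ : Fin m => isCompact_Icc (a := (0 : ℝ)) (b := 1))
    ?_ fun s hs j _ => hs.1 j
  simp only [HBLP, Set.mem_Icc, Set.ofPred_and, Set.ofPred_forall]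
  refine IsClosed.inter (isClosed_iInter fun j => IsClosed.inter ?_ ?_)
    (isClosed_iInter fun H => isClosed_iInter fun _ => ?_)
  · exact isClosed_le continuous_const (continuous_apply j)
  · exact isClosed_le (continuous_apply j) continuous_const
  · exact isClosed_le continuous_const (by fun_prop)

theorem convex_setOf_HBLP : Convex ℝ {s | HBLP φ s} := by
  intro s hs t ht a b ha hb hab
  refine ⟨fun j => convex_Icc (0 : ℝ) 1 (hs.1 j) (ht.1 j) ha hb hab, fun H hH => ?_⟩
  have h1 := mul_le_mul_of_nonneg_left (hs.2 H hH) ha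
  have h2 := mul_le_mul_of_nonneg_left (ht.2 H hH) hb
  simp only [Pi.add_apply, Pi.smul_apply, smul_eq_mul, add_mul, Finset.sum_add_distrib, mul_assoc,
    ← Finset.mul_sum]
  rw [← one_mul ((toNat _ : ℕ) : ℝ), ← hab, add_mul]
  exact add_le_add h1 h2

theorem eventually_HBLP_add_smul (h : HBLP φ s) (hG : Module.rank ℤ G < ℵ₀)
    (hcrit : ∀ V : AddSubgroup G, 0 < finrank ℤ V → finrank ℤ V < finrank ℤ G →
      (finrank ℤ V : ℝ) < ∑ j, s j * finrank ℤ (V.map (φ j)))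
    {v : Fin m → ℝ} (hv : ∀ j, v j ≠ 0 → s j ∈ Set.Ioo (0 : ℝ) 1)
    (hv0 : ∑ j, v j * finrank ℤ ((⊤ : AddSubgroup G).map (φ j)) = 0) :
    ∀ᶠ ε : ℝ in nhds 0, HBLP φ (s + ε • v) := by
  let rk : AddSubgroup G → ℕ × (Fin m → ℕ) := fun V =>
    (finrank ℤ V, fun j => finrank ℤ (V.map (φ j)))
  have hle : ∀ V : AddSubgroup G, finrank ℤ V ≤ finrank ℤ G := fun V =>
    finrank_le_finrank_of_rank_le_rank (lift_le.2
      (LinearMap.rank_le_of_injective V.subtype.toIntLinearMap V.subtype_injective)) hG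
  have hfin : (Set.range rk).Finite := by
    refine ((Set.finite_Iic (finrank ℤ G)).prod
      (Set.Finite.pi fun _ => Set.finite_Iic (finrank ℤ G))).subset ?_
    rintro _ ⟨V, rfl⟩
    exact ⟨hle V, fun j _ => (finrank_map_le _ _ (rank_addSubgroup_lt_aleph0 hG V)).trans (hle V)⟩
  have hbox : ∀ᶠ ε : ℝ in nhds 0, ∀ j, (s + ε • v) j ∈ Set.Icc (0 : ℝ) 1 := by
    refine Filter.eventually_all.2 fun j => ?_
    by_cases hj : v j = 0
    · exact .of_forall fun ε => by simpa [hj] using h.1 j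
    · have : Filter.Tendsto (fun ε : ℝ => (s + ε • v) j) (nhds 0) (nhds (s j)) := by
        refine Continuous.tendsto' ?_ _ _ (by simp)
        simp only [Pi.add_apply, Pi.smul_apply]
        fun_prop
      exact (this.eventually (Ioo_mem_nhds (hv j hj).1 (hv j hj).2)).mono
        fun ε hε => Set.Ioo_subset_Icc_self hε
  have hrk : ∀ᶠ ε : ℝ in nhds 0, ∀ π ∈ Set.range rk,
      (π.1 : ℝ) ≤ ∑ j, (s + ε • v) j * π.2 j := by
    refine (Filter.eventually_all_finite hfin).2 ?_
    rintro _ ⟨V, rfl⟩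
    have hexp : ∀ ε : ℝ, ∑ j, (s + ε • v) j * ((rk V).2 j : ℝ)
        = ∑ j, s j * ((rk V).2 j : ℝ) + ε * ∑ j, v j * ((rk V).2 j : ℝ) := fun ε => by
      simp [add_mul, Finset.sum_add_distrib, Finset.mul_sum, mul_assoc]
    simp only [hexp]
    have hV : ((rk V).1 : ℝ) ≤ ∑ j, s j * ((rk V).2 j : ℝ) := finrank_le_sum_of_HBLP h hG V
    rcases Nat.eq_zero_or_pos (finrank ℤ V) with h0 | h0
    · have : ∀ j, (rk V).2 j = 0 := fun j => Nat.le_zero.1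
        ((finrank_map_le _ _ (rank_addSubgroup_lt_aleph0 hG V)).trans h0.le)
      exact .of_forall fun ε => by simpa [this] using hV
    rcases (hle V).eq_or_lt with htop | hlt
    · have : ∀ j, (rk V).2 j = finrank ℤ ((⊤ : AddSubgroup G).map (φ j)) := fun j =>
        (finrank_map_eq_of_forall_exists_zsmul_mem (φ j) le_top
          (rank_addSubgroup_lt_aleph0 hG _)
          fun x _ => exists_zsmul_mem_of_finrank_eq hG htop x).symm
      have hz : ∑ j, v j * ((rk V).2 j : ℝ) = 0 := by simpa only [this] using hv0
      exact .of_forall fun ε => by simpa only [hz, mul_zero, add_zero] using hV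
    · have : Filter.Tendsto (fun ε : ℝ => ∑ j, s j * ((rk V).2 j : ℝ)
          + ε * ∑ j, v j * ((rk V).2 j : ℝ)) (nhds 0) (nhds (∑ j, s j * ((rk V).2 j : ℝ))) :=
        Continuous.tendsto' (by fun_prop) _ _ (by simp)
      exact (this.eventually (lt_mem_nhds (hcrit V h0 hlt))).mono fun ε hε => le_of_lt hε
  filter_upwards [hbox, hrk] with ε h1 h2
  exact ⟨h1, fun V _ => h2 _ ⟨V, rfl⟩⟩

/-- An extreme point of the polytope without critical subgroups of intermediate rank has at most
one coordinate in `(0,1)`. -/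
theorem eq_of_mem_extremePoints (h : s ∈ {s | HBLP φ s}.extremePoints ℝ)
    (hG : Module.rank ℤ G < ℵ₀)
    (hcrit : ∀ V : AddSubgroup G, 0 < finrank ℤ V → finrank ℤ V < finrank ℤ G →
      (finrank ℤ V : ℝ) < ∑ j, s j * finrank ℤ (V.map (φ j)))
    {i k : Fin m} (hi : s i ∈ Set.Ioo (0 : ℝ) 1) (hk : s k ∈ Set.Ioo (0 : ℝ) 1) : i = k := by
  by_contra hik
  let d : Fin m → ℝ := fun j => finrank ℤ ((⊤ : AddSubgroup G).map (φ j))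
  obtain ⟨v, hvne, hv, hv0⟩ : ∃ v : Fin m → ℝ, v ≠ 0 ∧
      (∀ j, v j ≠ 0 → s j ∈ Set.Ioo (0 : ℝ) 1) ∧ ∑ j, v j * d j = 0 := by
    by_cases hd : d i = 0
    · refine ⟨Pi.single i 1, by simp, fun j hj => ?_, ?_⟩
      · obtain rfl : j = i := by
          by_contra hji
          exact hj (Pi.single_eq_of_ne hji _)
        exact hi
      · simp [Pi.single_apply, hd]
    · refine ⟨Pi.single i (d k) - Pi.single k (d i), fun h0 => ?_, fun j hj => ?_, ?_⟩
      · have := congrFun h0 k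
        simp [Pi.single_eq_of_ne (Ne.symm hik), hd] at this
      · by_cases hji : j = i
        · rwa [hji]
        by_cases hjk : j = k
        · rwa [hjk]
        simp [Pi.single_eq_of_ne hji, Pi.single_eq_of_ne hjk] at hj
      · simp [Pi.single_apply, sub_mul, Finset.sum_sub_distrib, mul_comm]
  have hev := eventually_HBLP_add_smul h.1 hG hcrit hv hv0
  have hneg : ∀ᶠ ε : ℝ in nhds 0, HBLP φ (s + (-ε) • v) :=
    (continuous_neg.tendsto' (0 : ℝ) 0 neg_zero).eventually hev
  obtain ⟨δ, hδ, hball⟩ := Metric.eventually_nhds_iff.1 (hev.and hneg)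
  obtain ⟨h1, h2⟩ := hball (y := δ / 2) (by rw [Real.dist_eq, sub_zero, abs_of_pos] <;> linarith)
  have h3 := (mem_extremePoints.1 h).2 _ h1 _ h2
    ⟨1 / 2, 1 / 2, by norm_num, by norm_num, by norm_num, by module⟩
  refine hvne ((smul_eq_zero.1 (add_eq_left.1 h3.1)).resolve_left ?_)
  positivity

theorem HBLHolds.of_subsingleton_Ioo [IsAddTorsionFree G] (h : HBLP φ s)
    (hG : Module.rank ℤ G < ℵ₀)
    (hs : ∀ i k, s i ∈ Set.Ioo (0 : ℝ) 1 → s k ∈ Set.Ioo (0 : ℝ) 1 → i = k) :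
    HBLHolds φ s 1 := by
  classical
  let K : AddSubgroup G := ⨅ j, ⨅ _ : s j = 1, (φ j).ker
  have hmem : ∀ x, x ∈ K ↔ ∀ j, s j = 1 → φ j x = 0 := by
    simp [K, AddSubgroup.mem_iInf, AddMonoidHom.mem_ker]
  have hKr := rank_addSubgroup_lt_aleph0 hG K
  have hterm : ∀ j, s j ∉ Set.Ioo (0 : ℝ) 1 → s j * (finrank ℤ (K.map (φ j)) : ℝ) = 0 := by
    intro j hj
    rcases (h.1 j).1.eq_or_lt with h0 | h0
    · rw [← h0, zero_mul]
    · have h1 : s j = 1 := (h.1 j).2.eq_of_not_lt fun h1 => hj ⟨h0, h1⟩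
      have : K.map (φ j) = ⊥ := by
        rw [eq_bot_iff]
        rintro _ ⟨x, hx, rfl⟩
        exact (hmem x).1 hx j h1
      rw [this, Module.finrank_zero_of_subsingleton, Nat.cast_zero, mul_zero]
  have hK0 : finrank ℤ K = 0 := by
    have hle := finrank_le_sum_of_HBLP h hG K
    by_cases hex : ∃ i, s i ∈ Set.Ioo (0 : ℝ) 1
    · obtain ⟨i, hi⟩ := hex
      rw [Finset.sum_eq_single i (fun j _ hj => hterm j fun hj' => hj (hs _ _ hj' hi))
        (by simp)] at hle
      have hm : (finrank ℤ (K.map (φ i)) : ℝ) ≤ finrank ℤ K := by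
        exact_mod_cast finrank_map_le (φ i) K hKr
      by_contra h0
      have hpos : (0 : ℝ) < finrank ℤ K := by exact_mod_cast Nat.pos_of_ne_zero h0
      nlinarith [hi.1, hi.2]
    · push Not at hex
      rw [Finset.sum_eq_zero fun j _ => hterm j (hex j)] at hle
      exact_mod_cast le_antisymm hle (Nat.cast_nonneg _)
  have hK : ∀ x ∈ K, x = 0 := by
    intro x hx
    have hr := (toNat_eq_zero.1 hK0).resolve_right (not_le.2 hKr)
    obtain ⟨n, hn, hnx⟩ := rank_eq_zero_iff.1 hr ⟨x, hx⟩
    exact (smul_eq_zero.1 (congrArg Subtype.val hnx : n • x = 0)).resolve_left hn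
  intro p
  rw [one_mul, ENNReal.tsum_eq_iSup_sum]
  refine iSup_le fun E => ?_
  let e : G → ∀ j, Gj j := fun x j => if s j = 1 then φ j x else 0
  let g : ∀ j, Gj j → ℝ≥0∞ := fun j y => if s j = 1 then p j y else (∑' y, p j y) ^ s j
  have he : Function.Injective e := by
    intro x y hxy
    refine sub_eq_zero.1 (hK _ ((hmem _).2 fun j hj => ?_))
    have := congrFun hxy j
    simp only [e, hj, if_true] at this
    rw [map_sub, this, sub_self]
  calc ∑ x ∈ E, ∏ j, p j (φ j x) ^ s j ≤ ∑ x ∈ E, ∏ j, g j (e x j) := by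
        refine Finset.sum_le_sum fun x _ => Finset.prod_le_prod' fun j _ => ?_
        by_cases hj : s j = 1
        · simp [g, e, hj]
        · simp only [g, hj, if_false]
          exact ENNReal.rpow_le_rpow (ENNReal.le_tsum _) (h.1 j).1
    _ = ∑ y ∈ E.image e, ∏ j, g j (y j) := by
        rw [Finset.sum_image fun x _ y _ hxy => he hxy]
    _ ≤ ∑ y ∈ Fintype.piFinset fun j => E.image fun x => e x j, ∏ j, g j (y j) := by
        refine Finset.sum_le_sum_of_subset fun y hy => ?_
        obtain ⟨x, hx, rfl⟩ := Finset.mem_image.1 hy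
        exact Fintype.mem_piFinset.2 fun j => Finset.mem_image_of_mem (fun x => e x j) hx
    _ = ∏ j, ∑ y ∈ E.image fun x => e x j, g j y := (Finset.prod_univ_sum _ _).symm
    _ ≤ ∏ j, (∑' y, p j y) ^ s j := by
        refine Finset.prod_le_prod' fun j _ => ?_
        by_cases hj : s j = 1
        · simp only [g, e, hj, if_true, ENNReal.rpow_one]
          exact ENNReal.sum_le_tsum _
        · simp only [g, e, hj, if_false, Finset.sum_const]
          refine (nsmul_le_nsmul_left zero_le (Finset.card_le_one.2 ?_)).trans (one_nsmul _).le
          simp only [Finset.mem_image]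
          rintro _ ⟨_, _, rfl⟩ _ ⟨_, _, rfl⟩
          rfl

end

section

open Module Cardinal

theorem HBLHolds.mono {G : Type*} [AddCommGroup G] {m : ℕ} {Gj : Fin m → Type*}
    [∀ j, AddCommGroup (Gj j)] {φ : ∀ j, G →+ Gj j} {s : Fin m → ℝ} {C D : ℝ≥0∞}
    (h : HBLHolds φ s C) (hCD : C ≤ D) : HBLHolds φ s D :=
  fun p => (h p).trans (by gcongr)

/-- Weighted geometric means of positive densities are log-convex in the exponents, so that the
inequality with constant `1` only has to be checked at the extreme points of the polytope. -/
theorem HBLHolds.of_extremePoints {G : Type*} [AddCommGroup G] {m : ℕ} {Gj : Fin m → Type*}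
    [∀ j, AddCommGroup (Gj j)] {φ : ∀ j, G →+ Gj j}
    (h : ∀ t ∈ {t | HBLP φ t}.extremePoints ℝ, HBLHolds φ t 1) {s : Fin m → ℝ}
    (hs : HBLP φ s) : HBLHolds φ s 1 := by
  refine .of_density (fun j => (hs.1 j).1) one_ne_zero fun E p hpos hsupp hsum => ?_
  let L : G → (Fin m → ℝ) →ₗ[ℝ] ℝ := fun x =>
    ∑ j, Real.log (p j (φ j x)) • LinearMap.proj j
  have hL : ∀ x ∈ E, ∀ t : Fin m → ℝ, ∏ j, p j (φ j x) ^ t j = Real.exp (L x t) := by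
    intro x hx t
    simp [L, Real.exp_sum, Real.rpow_def_of_pos (hpos _ x hx)]
  let ψ : (Fin m → ℝ) → ℝ := fun t => ∑ x ∈ E, Real.exp (L x t)
  have hψ : ConvexOn ℝ Set.univ ψ := by
    have key : ∀ F : Finset G,
        ConvexOn ℝ Set.univ fun t : Fin m → ℝ => ∑ x ∈ F, Real.exp (L x t) := by
      classical
      intro F
      induction F using Finset.induction_on with
      | empty => simpa using convexOn_const (0 : ℝ) convex_univ
      | insert a F ha ih =>
        simp only [Finset.sum_insert ha]
        exact (convexOn_exp.comp_linearMap (L a)).add ih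
    exact key E
  have hcont : Continuous ψ := by
    refine continuous_finsetSum _ fun x _ => Real.continuous_exp.comp ?_
    exact LinearMap.continuous_of_finiteDimensional _
  have hconv : Convex ℝ {t | ψ t ≤ 1} := by simpa using hψ.convex_le 1
  have hclosed : IsClosed {t | ψ t ≤ 1} := isClosed_le hcont continuous_const
  have hnn : ∀ j y, 0 ≤ p j y := by
    intro j y
    by_cases hy : y ∈ φ j '' E
    · obtain ⟨x, hx, rfl⟩ := hy
      exact (hpos j x hx).le
    · exact (hsupp j y hy).ge
  have hext : {t | HBLP φ t}.extremePoints ℝ ⊆ {t | ψ t ≤ 1} := by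
    intro t ht
    have h1 := h t ht fun j y => ENNReal.ofReal (p j y)
    have htsum : ∀ j, ∑' y, ENNReal.ofReal (p j y) = 1 := fun j => by
      rw [← ENNReal.ofReal_tsum_of_nonneg (hnn j) (hsum j).summable, (hsum j).tsum_eq,
        ENNReal.ofReal_one]
    simp only [htsum, ENNReal.one_rpow, Finset.prod_const_one, mul_one] at h1
    have h2 : ENNReal.ofReal (ψ t) ≤ 1 := by
      refine le_trans (le_of_eq ?_) ((ENNReal.sum_le_tsum E).trans h1)
      rw [ENNReal.ofReal_sum_of_nonneg fun x _ => (Real.exp_pos _).le]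
      refine Finset.sum_congr rfl fun x hx => ?_
      rw [← hL x hx, ENNReal.ofReal_prod_of_nonneg fun j _ => Real.rpow_nonneg (hnn _ _) _]
      exact Finset.prod_congr rfl fun j _ => (ENNReal.ofReal_rpow_of_pos (hpos j x hx)).symm
    exact ENNReal.ofReal_le_one.1 h2
  have hmem : s ∈ {t | ψ t ≤ 1} := by
    have := closure_minimal (convexHull_min hext hconv) hclosed
    rw [closure_convexHull_extremePoints isCompact_setOf_HBLP convex_setOf_HBLP] at this
    exact this hs
  rw [Finset.sum_congr rfl fun x hx => hL x hx s]
  exact ENNReal.ofReal_le_one.2 hmem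

theorem HBLHolds.of_isAddTorsionFree {m : ℕ} (n : ℕ) {G : Type*} [AddCommGroup G]
    [IsAddTorsionFree G] (hG : Module.rank ℤ G < ℵ₀) (hn : finrank ℤ G = n)
    {Gj : Fin m → Type*} [∀ j, AddCommGroup (Gj j)] (φ : ∀ j, G →+ Gj j) (s : Fin m → ℝ)
    (hs : HBLP φ s) : HBLHolds φ s 1 := by
  induction n using Nat.strong_induction_on generalizing G Gj s with
  | h n ih =>
  refine .of_extremePoints (fun t ht => ?_) hs
  by_cases hcrit : ∀ V : AddSubgroup G, 0 < finrank ℤ V → finrank ℤ V < finrank ℤ G →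
      (finrank ℤ V : ℝ) < ∑ j, t j * finrank ℤ (V.map (φ j))
  · exact .of_subsingleton_Ioo ht.1 hG fun i k hi hk => eq_of_mem_extremePoints ht hG hcrit hi hk
  push Not at hcrit
  obtain ⟨V, hV0, hVG, hV⟩ := hcrit
  have hVr := rank_addSubgroup_lt_aleph0 hG V.saturation
  have hV1 : finrank ℤ V.saturation = finrank ℤ V :=
    finrank_eq_of_forall_exists_zsmul_mem V.le_saturation hVr fun x hx => hx
  have hV2 : ∀ j, finrank ℤ (V.saturation.map (φ j)) = finrank ℤ (V.map (φ j)) := fun j =>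
    finrank_map_eq_of_forall_exists_zsmul_mem (φ j) V.le_saturation hVr fun x hx => hx
  have hV3 : (finrank ℤ V.saturation : ℝ) = ∑ j, t j * finrank ℤ (V.saturation.map (φ j)) :=
    (finrank_le_sum_of_HBLP ht.1 hG _).antisymm (by simpa only [hV1, hV2] using hV)
  have hq : finrank ℤ (G ⧸ V.saturation) < n := by
    have h1 := finrank_map_mk_add_finrank (le_top : V.saturation ≤ ⊤)
      (rank_addSubgroup_lt_aleph0 hG _)
    have h2 : finrank ℤ (⊤ : AddSubgroup G) = finrank ℤ G :=
      AddSubgroup.topEquiv.toIntLinearEquiv.finrank_eq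
    have h3 : finrank ℤ ((⊤ : AddSubgroup G).map (QuotientAddGroup.mk' V.saturation))
        = finrank ℤ (G ⧸ V.saturation) := by
      rw [AddSubgroup.map_top_of_surjective _ (QuotientAddGroup.mk'_surjective _)]
      exact AddSubgroup.topEquiv.toIntLinearEquiv.finrank_eq
    omega
  rw [← one_mul 1]
  refine .of_subgroup_of_quotient V.saturation ?_ ?_
  · exact ih _ (by omega) hVr rfl _ _ (ht.1.comp_subtype _)
  · exact ih _ hq (rank_quotient_lt_aleph0 hG _) rfl _ _ (ht.1.quotient hG _ hV3)

theorem HBLHolds.of_HBLP {G : Type*} [AddCommGroup G] {m : ℕ} {Gj : Fin m → Type*}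
    [∀ j, AddCommGroup (Gj j)] (φ : ∀ j, G →+ Gj j) (s : Fin m → ℝ) (hs : HBLP φ s) :
    HBLHolds φ s (HBLA φ s) := by
  refine .of_fg fun V hV => ?_
  have : Module.Finite ℤ V := Module.Finite.iff_addGroup_fg.2
    ((AddGroup.fg_iff_addSubgroup_fg V).2 hV)
  have hr : Module.rank ℤ V < ℵ₀ := rank_lt_aleph0 ℤ V
  let T : AddSubgroup V := AddCommGroup.torsion V
  have hTfin : Finite T := by
    have : AddGroup.FG T := Module.Finite.iff_addGroup_fg.1
      (inferInstanceAs (Module.Finite ℤ (AddSubgroup.toIntSubmodule T)))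
    exact AddCommGroup.finite_of_fg_isAddTorsion _ (AddCommMonoid.addTorsion.isAddTorsion)
  have hT0 : finrank ℤ T = 0 := by
    rw [finrank_eq_of_forall_exists_zsmul_mem (bot_le : ⊥ ≤ T) (rank_addSubgroup_lt_aleph0 hr T)
      fun x hx => ?_]
    · exact Module.finrank_zero_of_subsingleton
    · obtain ⟨n, hn, hnx⟩ := IsOfFinAddOrder.exists_nsmul_eq_zero (show IsOfFinAddOrder x from hx)
      exact ⟨n, by omega, AddSubgroup.mem_bot.2 (by rw [natCast_zsmul, hnx])⟩
  have hT1 : ∀ j, finrank ℤ (T.map ((φ j).comp V.subtype)) = 0 := fun j =>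
    Nat.le_zero.1 ((finrank_map_le _ T (rank_addSubgroup_lt_aleph0 hr T)).trans hT0.le)
  have hP := hs.comp_subtype V
  refine HBLHolds.mono (.of_subgroup_of_quotient T (.of_finite _ fun j => (hs.1 j).1)
    (.of_isAddTorsionFree _ (rank_quotient_lt_aleph0 hr T) rfl _ _
      (hP.quotient hr T ?_))) ?_
  · simp only [hT0, hT1, Nat.cast_zero, mul_zero, Finset.sum_const_zero]
  · rw [mul_one]
    exact (HBLA_comp_subtype_le _ T).trans (HBLA_comp_subtype_le φ V)

theorem tsum_indicator_one_eq_natCard {α : Type*} {S : Set α} (hS : S.Finite) :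
    ∑' x, S.indicator (1 : α → ℝ≥0∞) x = Nat.card S := by
  rw [← tsum_subtype]
  have := hS.fintype
  simp

theorem HBLA_le_HBLB {G : Type*} [AddCommGroup G] {m : ℕ} {Gj : Fin m → Type*}
    [∀ j, AddCommGroup (Gj j)] (φ : ∀ j, G →+ Gj j) {s : Fin m → ℝ}
    (hs : ∀ j, 0 ≤ s j) : HBLA φ s ≤ HBLB φ s := by
  refine iSup₂_le fun H hH => le_sInf fun C hC => ?_
  have hfin : ∀ j, (H.map (φ j) : Set (Gj j)).Finite := fun j => by
    rw [AddSubgroup.coe_map]; exact hH.image _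
  have hcard : ∀ j, (Nat.card (H.map (φ j)) : ℝ≥0∞) ≠ 0 := fun j => by
    have : Finite (H.map (φ j)) := hfin j
    exact_mod_cast Nat.card_pos.ne'
  have hcard' : ∀ j, (Nat.card (H.map (φ j)) : ℝ≥0∞) ≠ ∞ := fun j => ENNReal.natCast_ne_top _
  let f : ∀ j, Gj j → ℝ≥0∞ := fun j => (H.map (φ j) : Set (Gj j)).indicator 1
  have hnorm : ∀ j, HBLnorm (s j) (f j) ≤ (Nat.card (H.map (φ j)) : ℝ≥0∞) ^ s j := by
    intro j
    unfold HBLnorm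
    split_ifs with h0
    · rw [h0, ENNReal.rpow_zero]
      exact iSup_le fun y => Set.indicator_le_self' (fun _ _ => zero_le) y
    · have h1 : ∀ y, f j y ^ (1 / s j) = f j y := fun y => by
        have hpos : 0 < 1 / s j := one_div_pos.2 ((hs j).lt_of_ne' h0)
        by_cases hy : y ∈ (H.map (φ j) : Set (Gj j))
        · simp only [f, Set.indicator_of_mem hy, Pi.one_apply, ENNReal.one_rpow]
        · simp only [f, Set.indicator_of_notMem hy, ENNReal.zero_rpow_of_pos hpos]
      simp only [h1]
      exact (congrArg (· ^ s j) (tsum_indicator_one_eq_natCard (hfin j))).le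
  have hle : (Nat.card H : ℝ≥0∞) ≤ C * ∏ j, (Nat.card (H.map (φ j)) : ℝ≥0∞) ^ s j := by
    refine le_trans ?_ ((hC f).trans (by gcongr with j; exact hnorm j))
    refine (tsum_indicator_one_eq_natCard hH).symm.le.trans ?_
    refine ENNReal.tsum_le_tsum fun x => ?_
    by_cases hx : x ∈ H
    · have h1 : ∀ j, f j (φ j x) = 1 := fun j =>
        Set.indicator_of_mem (AddSubgroup.mem_map_of_mem (φ j) hx) _
      simp only [h1, Finset.prod_const_one]
      exact Set.indicator_le_self' (fun _ _ => zero_le) x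
    · exact (Set.indicator_of_notMem hx _).trans_le zero_le
  calc HBLAloc φ s H ≤ (C * ∏ j, (Nat.card (H.map (φ j)) : ℝ≥0∞) ^ s j)
        * ∏ j, (Nat.card (H.map (φ j)) : ℝ≥0∞) ^ (-(s j)) := by
        unfold HBLAloc; gcongr
    _ = C := by
        rw [mul_assoc, ← Finset.prod_mul_distrib, Finset.prod_eq_one, mul_one]
        intro j _
        rw [← ENNReal.rpow_add _ _ (hcard j) (hcard' j), add_neg_cancel, ENNReal.rpow_zero]

end

/-- **Theorem (general groups, direct part).** For any Abelian group HBL datum `𝒢` and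
any `s ∈ 𝒫(𝒢)`, one has `𝔹(𝒢,s) = 𝔸(𝒢,s)`. -/
theorem general_HBL_optimal_constant {G : Type*} [AddCommGroup G]
    {m : ℕ} (hm : 0 < m) {Gj : Fin m → Type*} [∀ j, AddCommGroup (Gj j)]
    (φ : ∀ j, G →+ Gj j) (s : Fin m → ℝ) (hs : HBLP φ s) :
    HBLB φ s = HBLA φ s :=
  le_antisymm (sInf_le (HBLHolds.of_HBLP φ s hs).le_norm) (HBLA_le_HBLB φ fun j => (hs.1 j).1)
end

section
/- Let 𝒢 = (φ_j : G → G_j : 1 ≤ j ≤ m) be an Abelian group HBL datum and let s ∈ [0,1]^m. If there exists a constant C < ∞ such that |E| ≤ C · ∏_{j=1}^m |φ_j(E)|^{s_j} for every nonempty finite subset E ⊂ G, then s ∈ 𝒫(𝒢) and C ≥ 𝔸(𝒢,s). -/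
open scoped ENNReal

/-- If `M` embeds in `ℤ ^ k × T` with `T` finite, then combinations of finitely many elements
of `M` with natural coefficients below `N` take at most `O(N ^ k)` values. -/
theorem exists_card_range_sum_smul_le_of_injective {M T : Type*} [AddCommGroup M]
    [AddCommGroup T] [Finite T] {k r : ℕ} (f : M →+ (Fin k →₀ ℤ) × T)
    (hf : Function.Injective f) (v : Fin r → M) :
    ∃ B : ℕ, ∀ N : ℕ, 0 < N →
      Nat.card (Set.range fun n : Fin r → Fin N => ∑ i, (n i : ℕ) • v i) ≤ B * N ^ k := by
  obtain ⟨b, hb⟩ : ∃ b : ℕ, b = ∑ l, ∑ i, ((f (v i)).1 l).natAbs := ⟨_, rfl⟩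
  refine ⟨(2 * b + 1) ^ k * Nat.card T, fun N hN => ?_⟩
  have hbound : ∀ (n : Fin r → Fin N) (l : Fin k),
      (f (∑ i, (n i : ℕ) • v i)).1 l ∈ Finset.Icc (-(N * b : ℤ)) (N * b) := by
    intro n l
    have h1 : (f (∑ i, (n i : ℕ) • v i)).1 l = ∑ i, ((n i : ℕ) : ℤ) * (f (v i)).1 l := by
      simp [map_sum, Prod.fst_sum, Finsupp.finsetSum_apply]
    rw [Finset.mem_Icc, ← abs_le, h1]
    calc |∑ i, ((n i : ℕ) : ℤ) * (f (v i)).1 l|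
        ≤ ∑ i, |((n i : ℕ) : ℤ) * (f (v i)).1 l| := Finset.abs_sum_le_sum_abs _ _
      _ ≤ ∑ i, (N : ℤ) * ((f (v i)).1 l).natAbs := by
          refine Finset.sum_le_sum fun i _ => ?_
          rw [abs_mul, Int.natCast_natAbs, Nat.abs_cast]
          gcongr
          exact (n i).isLt.le
      _ ≤ N * b := by
          rw [← Finset.mul_sum, ← Nat.cast_sum]
          gcongr
          rw [hb]
          exact Finset.single_le_sum (f := fun l => ∑ i, ((f (v i)).1 l).natAbs)
            (fun _ _ => Nat.zero_le _) (Finset.mem_univ l)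
  let g : Set.range (fun n : Fin r → Fin N => ∑ i, (n i : ℕ) • v i) →
      (Fin k → Finset.Icc (-(N * b : ℤ)) (N * b)) × T :=
    fun x => (fun l => ⟨(f x).1 l, by obtain ⟨_, n, rfl⟩ := x; exact hbound n l⟩, (f x).2)
  have hg : Function.Injective g := by
    intro x y hxy
    refine Subtype.ext (hf (Prod.ext (Finsupp.ext fun l => ?_) (congrArg (fun z => z.2) hxy)))
    exact congrArg Subtype.val (congrFun (congrArg Prod.fst hxy) l)
  calc _ ≤ _ := Nat.card_le_card_of_injective g hg
    _ = (2 * (N * b) + 1) ^ k * Nat.card T := by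
        rw [Nat.card_prod, Nat.card_pi, Finset.prod_const, Finset.card_univ, Fintype.card_fin,
          Nat.card_eq_fintype_card, Fintype.card_coe, Int.card_Icc]
        congr 2
        zify
        rw [Int.toNat_of_nonneg (by linarith [show (0 : ℤ) ≤ N * b by positivity])]
        ring
    _ ≤ ((2 * b + 1) * N) ^ k * Nat.card T := by
        gcongr
        nlinarith
    _ = _ := by rw [mul_pow, mul_right_comm]

/-- Combinations of finitely many elements with natural coefficients below `N` take at most
`O(N ^ k)` values, where `k` is the rank of the subgroup they generate. -/
theorem exists_card_range_sum_smul_le {A : Type*} [AddCommGroup A] {r : ℕ} (v : Fin r → A) :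
    ∃ B : ℕ, ∀ N : ℕ, 0 < N →
      Nat.card (Set.range fun n : Fin r → Fin N => ∑ i, (n i : ℕ) • v i) ≤
        B * N ^ Module.finrank ℤ (Submodule.span ℤ (Set.range v)) := by
  set M := Submodule.span ℤ (Set.range v) with hM
  have : Module.Finite ℤ M := Module.Finite.span_of_finite ℤ (Set.finite_range v)
  have : AddGroup.FG M := Module.Finite.iff_addGroup_fg.1 inferInstance
  obtain ⟨k, ι, _, p, hp, e, ⟨f⟩⟩ := AddCommGroup.equiv_free_prod_directSum_zmod M
  have : ∀ i, NeZero (p i ^ e i) := fun i => ⟨pow_ne_zero _ (hp i).ne_zero⟩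
  have : Finite (DirectSum ι fun i => ZMod (p i ^ e i)) :=
    Finite.of_equiv _ (DirectSum.addEquivProd _).symm.toEquiv
  have hk : k ≤ Module.finrank ℤ M := by
    have h := LinearMap.finrank_le_finrank_of_injective
      (f := (f.symm.toAddMonoidHom.comp
        (AddMonoidHom.inl (Fin k →₀ ℤ) (DirectSum ι fun i => ZMod (p i ^ e i)))).toIntLinearMap)
      (fun x y hxy => congrArg Prod.fst (f.symm.injective hxy))
    simpa using h
  let w : Fin r → M := fun i => ⟨v i, Submodule.subset_span ⟨i, rfl⟩⟩
  obtain ⟨B, hB⟩ := exists_card_range_sum_smul_le_of_injective f.toAddMonoidHom f.injective w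
  refine ⟨B, fun N hN => ?_⟩
  have himage : (Set.range fun n : Fin r → Fin N => ∑ i, (n i : ℕ) • v i) =
      M.subtype '' (Set.range fun n : Fin r → Fin N => ∑ i, (n i : ℕ) • w i) := by
    rw [← Set.range_comp]
    congr 1
    ext n
    simp [w]
  rw [himage, Nat.card_image_of_injective M.subtype_injective]
  exact (hB N hN).trans (by gcongr)

/-- A power of `N` bounded by a constant multiple of another power has the smaller exponent. -/
theorem le_of_forall_natCast_rpow_le {a d K : ℝ}
    (h : ∀ N : ℕ, 0 < N → (N : ℝ) ^ a ≤ K * (N : ℝ) ^ d) : a ≤ d := by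
  by_contra! hlt
  have ht := (tendsto_rpow_atTop (sub_pos.2 hlt)).comp (tendsto_natCast_atTop_atTop (R := ℝ))
  obtain ⟨N, hN, hN0⟩ :=
    ((ht.eventually_gt_atTop K).and (Filter.eventually_gt_atTop 0)).exists
  have hpos : (0 : ℝ) < N := Nat.cast_pos.2 hN0
  have h1 := h N hN0
  rw [← div_le_iff₀ (Real.rpow_pos_of_pos hpos d), ← Real.rpow_sub hpos] at h1
  exact absurd hN (not_lt.2 h1)

theorem HBLAloc_le_of_card_le {G : Type*} [AddCommGroup G] {m : ℕ} {Gj : Fin m → Type*}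
    [∀ j, AddCommGroup (Gj j)] (φ : ∀ j, G →+ Gj j) (s : Fin m → ℝ) (C : ℝ≥0∞)
    (H : AddSubgroup G) (hH : (H : Set G).Finite)
    (h : (Nat.card H : ℝ≥0∞) ≤ C * ∏ j, (Nat.card (H.map (φ j)) : ℝ≥0∞) ^ (s j)) :
    HBLAloc φ s H ≤ C := by
  have hne : ∀ j, (Nat.card (H.map (φ j)) : ℝ≥0∞) ≠ 0 := fun j => by
    have : Finite (H.map (φ j)) := (hH.image (φ j)).to_subtype
    exact Nat.cast_ne_zero.2 Nat.card_pos.ne'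
  calc HBLAloc φ s H ≤ (C * ∏ j, (Nat.card (H.map (φ j)) : ℝ≥0∞) ^ (s j)) *
        ∏ j, (Nat.card (H.map (φ j)) : ℝ≥0∞) ^ (-(s j)) := by
        unfold HBLAloc
        gcongr
    _ = C := by
        rw [mul_assoc, ← Finset.prod_mul_distrib, Finset.prod_eq_one, mul_one]
        intro j _
        rw [← ENNReal.rpow_add _ _ (hne j) (ENNReal.natCast_ne_top _), add_neg_cancel,
          ENNReal.rpow_zero]

/-- **Theorem (general groups, converse part).** If `s ∈ [0,1]^m` and there is a finite
constant `C` with `|E| ≤ C ∏_j |φ_j(E)|^{s_j}` for every nonempty finite subset `E ⊆ G`,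
then `s ∈ 𝒫(𝒢)` and `C ≥ 𝔸(𝒢,s)`. -/
theorem general_HBL_converse {G : Type*} [AddCommGroup G]
    {m : ℕ} (hm : 0 < m) {Gj : Fin m → Type*} [∀ j, AddCommGroup (Gj j)]
    (φ : ∀ j, G →+ Gj j) (s : Fin m → ℝ) (hs : ∀ j, s j ∈ Set.Icc (0 : ℝ) 1)
    (C : ℝ≥0∞) (hC : C ≠ ⊤)
    (hE : ∀ E : Finset G, E.Nonempty →
      (E.card : ℝ≥0∞) ≤ C * ∏ j, (Nat.card (φ j '' (E : Set G)) : ℝ≥0∞) ^ (s j)) :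
    HBLP φ s ∧ HBLA φ s ≤ C := by
  classical
  refine ⟨⟨hs, fun H hH => ?_⟩, ?_⟩
  · obtain ⟨e, he⟩ := exists_linearIndependent_of_le_finrank (R := ℤ) (M := H) le_rfl
    replace he : LinearIndependent ℤ (fun i => (e i : G)) :=
      he.map' H.subtype.toIntLinearMap (LinearMap.ker_eq_bot.2 Subtype.val_injective)
    change ((Module.finrank ℤ H : ℕ) : ℝ) ≤ ∑ j, s j * (Module.finrank ℤ (H.map (φ j)) : ℝ)
    generalize Module.finrank ℤ H = r at e he ⊢
    have hrank : ∀ j, Module.finrank ℤ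
        (Submodule.span ℤ (Set.range fun i => φ j (e i))) ≤ Module.finrank ℤ (H.map (φ j)) := by
      intro j
      have hlt : Module.rank ℤ (H.map (φ j)) < Cardinal.aleph0 :=
        Cardinal.lift_lt_aleph0.1 <|
          (lift_rank_map_le (φ j).toIntLinearMap (AddSubgroup.toIntSubmodule H)).trans_lt
            (Cardinal.lift_lt_aleph0.2 hH)
      have hle : Submodule.span ℤ (Set.range fun i => φ j (e i)) ≤
          AddSubgroup.toIntSubmodule (H.map (φ j)) := by
        rw [Submodule.span_le]
        rintro _ ⟨i, rfl⟩
        exact ⟨e i, (e i).2, rfl⟩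
      exact Cardinal.toNat_le_toNat (Submodule.rank_mono hle) hlt
    choose B hB using fun j => exists_card_range_sum_smul_le (fun i => φ j (e i))
    refine le_of_forall_natCast_rpow_le
      (K := C.toReal * ∏ j, (B j : ℝ) ^ s j) fun N hN => ?_
    have hN0 : (0 : ℝ) < N := Nat.cast_pos.2 hN
    have : NeZero N := ⟨hN.ne'⟩
    let S : (Fin r → Fin N) → G := fun n => ∑ i, (n i : ℕ) • (e i : G)
    have hS : Function.Injective S := by
      intro a b hab
      have h := Fintype.linearIndependent_iff.1 he (fun i => ((a i : ℕ) : ℤ) - ((b i : ℕ) : ℤ))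
        (by simpa [S, sub_smul, sub_eq_zero] using hab)
      funext i
      exact Fin.ext (Nat.cast_injective (sub_eq_zero.1 (h i)))
    have hcard := hE (Finset.univ.image S) (Finset.univ_nonempty.image S)
    have himage : ∀ j, φ j '' (Finset.univ.image S : Finset G) =
        Set.range fun n : Fin r → Fin N => ∑ i, (n i : ℕ) • φ j (e i) := by
      intro j
      rw [Finset.coe_image, Finset.coe_univ, Set.image_univ, ← Set.range_comp]
      congr 1
      ext n
      simp [S]
    rw [Finset.card_image_of_injective _ hS, Finset.card_univ, Fintype.card_fun,
      Fintype.card_fin, Fintype.card_fin] at hcard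
    have hreal : ((N ^ r : ℕ) : ℝ) ≤
        C.toReal * ∏ j, (Nat.card (φ j '' (Finset.univ.image S : Finset G)) : ℝ) ^ s j := by
      have hfin : ∀ j, (Nat.card (φ j '' (Finset.univ.image S : Finset G)) : ℝ≥0∞) ^ s j ≠ ⊤ :=
        fun j => ENNReal.rpow_ne_top_of_nonneg (hs j).1 (ENNReal.natCast_ne_top _)
      have h := ENNReal.toReal_mono
        (ENNReal.mul_ne_top hC (ENNReal.prod_ne_top fun j _ => hfin j)) hcard
      simpa only [ENNReal.toReal_mul, ENNReal.toReal_prod, ← ENNReal.toReal_rpow,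
        ENNReal.toReal_natCast] using h
    calc (N : ℝ) ^ (r : ℝ) = ((N ^ r : ℕ) : ℝ) := by simp
      _ ≤ _ := hreal
      _ ≤ C.toReal * ∏ j, ((B j : ℝ) * (N : ℝ) ^ (Module.finrank ℤ (H.map (φ j)) : ℝ)) ^ s j := by
          refine mul_le_mul_of_nonneg_left (Finset.prod_le_prod (fun j _ => by positivity)
            fun j _ => Real.rpow_le_rpow (by positivity) ?_ (hs j).1) ENNReal.toReal_nonneg
          rw [himage j, Real.rpow_natCast]
          exact_mod_cast (hB j N hN).trans
            (Nat.mul_le_mul_left _ (Nat.pow_le_pow_right hN (hrank j)))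
      _ = _ := by
          rw [mul_assoc, Real.rpow_sum_of_pos hN0, ← Finset.prod_mul_distrib]
          congr 1
          refine Finset.prod_congr rfl fun j _ => ?_
          rw [Real.mul_rpow (by positivity) (by positivity), ← Real.rpow_mul hN0.le, mul_comm (s j)]
  · refine iSup₂_le fun H hH => HBLAloc_le_of_card_le φ s C H hH ?_
    have h := hE hH.toFinset ⟨0, by simp⟩
    rw [hH.coe_toFinset, ← Nat.card_eq_card_finite_toFinset hH] at h
    exact h
end

section
/- Let 𝒢 = (φ_j : G → G_j : 1 ≤ j ≤ m) be an Abelian group HBL datum and let s ∈ [0,1]^m. Let K be the intersection of the kernels Ker(φ_k) over all indices k with s_k = 1. If K = {0}, then 𝔹(𝒢,s) = 1. -/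
open scoped ENNReal

theorem ENNReal.tsum_prod_le_prod_tsum_of_injOn {ι : Type*} {α : ι → Type*}
    (f : ∀ i, α i → ℝ≥0∞) (T : Finset ι) {X : Type*} (g : X → ∀ i, α i)
    (hg : ∀ x y, (∀ i ∈ T, g x i = g y i) → x = y) :
    ∑' x, ∏ i ∈ T, f i (g x i) ≤ ∏ i ∈ T, ∑' y, f i y := by
  classical
  induction T using Finset.induction_on generalizing X with
  | empty =>
    have : Subsingleton X := ⟨fun x y => hg x y (by simp)⟩
    simp only [Finset.prod_empty]
    rcases isEmpty_or_nonempty X with h | ⟨⟨x⟩⟩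
    · simp
    · rw [tsum_eq_single x fun y hy => absurd (Subsingleton.elim y x) hy]
  | insert a T ha ih =>
    rw [Finset.prod_insert ha, ← (Equiv.sigmaFiberEquiv fun x => g x a).tsum_eq,
      ENNReal.tsum_sigma', ← ENNReal.tsum_mul_right]
    refine ENNReal.tsum_le_tsum fun y => ?_
    have hterm (x : {x // g x a = y}) :
        ∏ i ∈ insert a T, f i (g x i) = f a y * ∏ i ∈ T, f i (g x i) := by
      rw [Finset.prod_insert ha, x.2]
    calc ∑' x : {x // g x a = y}, ∏ i ∈ insert a T, f i (g x i)
        = f a y * ∑' x : {x // g x a = y}, ∏ i ∈ T, f i (g x i) := by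
          simp_rw [hterm, ENNReal.tsum_mul_left]
      _ ≤ f a y * ∏ i ∈ T, ∑' z, f i z := by
          gcongr
          refine ih (fun x : {x // g x a = y} => g x) fun x z h => 
            Subtype.ext (hg _ _ fun i hi => ?_)
          rcases Finset.mem_insert.1 hi with rfl | hi
          · exact x.2.trans z.2.symm
          · exact h i hi

theorem le_HBLnorm {α : Type*} {s : ℝ} (hs : 0 ≤ s) (f : α → ℝ≥0∞) (y : α) :
    f y ≤ HBLnorm s f := by
  unfold HBLnorm
  split_ifs with h
  · exact le_iSup f y
  · calc f y = (f y ^ (1 / s)) ^ s := by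
          rw [← ENNReal.rpow_mul, one_div_mul_cancel h, ENNReal.rpow_one]
      _ ≤ _ := ENNReal.rpow_le_rpow (ENNReal.le_tsum y) hs

theorem HBLnorm_one {α : Type*} (f : α → ℝ≥0∞) : HBLnorm 1 f = ∑' y, f y := by
  simp [HBLnorm]

open Classical in
theorem HBLnorm_single_one {α : Type*} [Zero α] {s : ℝ} (hs : 0 ≤ s) :
    HBLnorm s (Pi.single (0 : α) (1 : ℝ≥0∞) : α → ℝ≥0∞) = 1 := by
  unfold HBLnorm
  split_ifs with h
  · refine le_antisymm (iSup_le fun y => ?_) (le_iSup_of_le 0 (by simp))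
    by_cases hy : y = 0 <;> simp [hy]
  · have hpos : 0 < 1 / s := one_div_pos.2 (lt_of_le_of_ne hs (Ne.symm h))
    rw [tsum_eq_single 0 fun y hy => by
      rw [Pi.single_eq_of_ne hy, ENNReal.zero_rpow_of_pos hpos]]
    simp

/-- **Lemma.** Let `K` be the intersection of the kernels of `φ_k` over all indices `k`
with `s_k = 1` (the whole of `G` if there are no such indices). If `K = {0}`, then
`𝔹(𝒢,s) = 1`. -/
theorem HBLB_eq_one_of_inf_ker_eq_bot {G : Type*} [AddCommGroup G]
    {m : ℕ} (hm : 0 < m) {Gj : Fin m → Type*} [∀ j, AddCommGroup (Gj j)]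
    (φ : ∀ j, G →+ Gj j) (s : Fin m → ℝ) (hs : ∀ j, s j ∈ Set.Icc (0 : ℝ) 1)
    (hK : (⨅ (k : Fin m) (_ : s k = 1), (φ k).ker) = ⊥) :
    HBLB φ s = 1 := by
  classical
  refine le_antisymm (sInf_le fun f => ?_) (le_sInf fun C hC => ?_)
  · rw [one_mul]
    have hinj (x y : G) (h : ∀ j ∈ Finset.univ.filter (s · = 1), φ j x = φ j y) : x = y := by
      rw [← sub_eq_zero, ← AddSubgroup.mem_bot, ← hK]
      simp only [AddSubgroup.mem_iInf, AddMonoidHom.mem_ker, map_sub, sub_eq_zero]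
      exact fun k hk => h k (by simpa using hk)
    calc ∑' x, ∏ j, f j (φ j x)
        = ∑' x, (∏ j with s j = 1, f j (φ j x)) * ∏ j with ¬ s j = 1, f j (φ j x) := by
          simp_rw [Finset.prod_filter_mul_prod_filter_not]
      _ ≤ ∑' x, (∏ j with s j = 1, f j (φ j x)) * ∏ j with ¬ s j = 1, HBLnorm (s j) (f j) := by
          gcongr with x j
          exact le_HBLnorm (hs j).1 _ _
      _ ≤ (∏ j with s j = 1, ∑' y, f j y) * ∏ j with ¬ s j = 1, HBLnorm (s j) (f j) := by
          rw [ENNReal.tsum_mul_right]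
          gcongr
          exact ENNReal.tsum_prod_le_prod_tsum_of_injOn f _ (fun x j => φ j x) hinj
      _ = ∏ j, HBLnorm (s j) (f j) := by
          rw [← Finset.prod_filter_mul_prod_filter_not Finset.univ (s · = 1)]
          congr 1
          refine Finset.prod_congr rfl fun j hj => ?_
          rw [(Finset.mem_filter.1 hj).2, HBLnorm_one]
  · have h := hC fun j => Pi.single 0 1
    simp only [HBLnorm_single_one (hs _).1, Finset.prod_const_one, mul_one] at h
    refine le_trans ?_ ((ENNReal.le_tsum (0 : G)).trans h)
    simp
end

section
/- Let 𝒢 = (φ_j : G → G_j : 1 ≤ j ≤ m) be a finite Abelian group HBL datum (i.e., G and all G_j are finite) and let s ∈ [0,1]^m. Let G' ≤ G be a subgroup, let 𝒢' = (φ_j|_{G'} : G' → φ_j(G')) be the associated sub-datum, and let 𝒢/𝒢' = (ψ_j : G/G' → G_j/φ_j(G')) be the associated quotient datum. If A(G',s) = 𝔸(𝒢',s), then 𝔸(𝒢/𝒢',s) · 𝔸(𝒢',s) ≤ 𝔸(𝒢,s). -/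
open scoped ENNReal

/-- The preimage in `G` of a subgroup of `G ⧸ N` has cardinality the product of the
cardinalities. -/
theorem AddSubgroup.card_comap_quotient_mk {G : Type*} [AddCommGroup G] (N : AddSubgroup G)
    (K : AddSubgroup (G ⧸ N)) :
    Nat.card (K.comap (QuotientAddGroup.mk' N)) = Nat.card K * Nat.card N := by
  rw [mul_comm, ← Nat.card_prod]
  exact Nat.card_congr (QuotientAddGroup.preimageMkEquivAddSubgroupProdSet N (K : Set (G ⧸ N)))

/-- Pulling back to `G` and mapping to `H` agrees with mapping along the induced homomorphism of
quotients and pulling back to `H`. -/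
theorem AddSubgroup.comap_mk_map_quotientMap {G H : Type*} [AddCommGroup G] [AddCommGroup H]
    (φ : G →+ H) (N : AddSubgroup G) (K : AddSubgroup (G ⧸ N)) :
    (K.map (QuotientAddGroup.map N (N.map φ) φ
        (fun _ hx => AddSubgroup.mem_map_of_mem φ hx))).comap
      (QuotientAddGroup.mk' (N.map φ)) = (K.comap (QuotientAddGroup.mk' N)).map φ := by
  ext y
  simp only [AddSubgroup.mem_comap, AddSubgroup.mem_map]
  constructor
  · rintro ⟨q, hq, h⟩
    obtain ⟨x, rfl⟩ := QuotientAddGroup.mk_surjective q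
    obtain ⟨n, hn, hny⟩ := QuotientAddGroup.eq.mp h
    refine ⟨x + n, ?_, ?_⟩
    · rw [map_add, QuotientAddGroup.mk'_apply, QuotientAddGroup.mk'_apply,
        (QuotientAddGroup.eq_zero_iff n).mpr hn, add_zero]
      exact hq
    · rw [map_add, hny, add_neg_cancel_left]
  · rintro ⟨x, hx, rfl⟩
    exact ⟨QuotientAddGroup.mk' N x, hx, rfl⟩

/-- `A` is multiplicative along `0 → G' → H → K → 0`, where `H` is the preimage of `K`. -/
theorem HBLAloc_quotient_mul {G : Type*} [AddCommGroup G]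
    {m : ℕ} {Gj : Fin m → Type*} [∀ j, AddCommGroup (Gj j)]
    (φ : ∀ j, G →+ Gj j)
    (s : Fin m → ℝ) (G' : AddSubgroup G) (K : AddSubgroup (G ⧸ G')) :
    HBLAloc (fun j => QuotientAddGroup.map G' (G'.map (φ j)) (φ j)
        (fun _ hx => AddSubgroup.mem_map_of_mem (φ j) hx)) s K * HBLAloc φ s G' =
      HBLAloc φ s (K.comap (QuotientAddGroup.mk' G')) := by
  unfold HBLAloc
  rw [mul_mul_mul_comm, ← Finset.prod_mul_distrib, AddSubgroup.card_comap_quotient_mk,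
    Nat.cast_mul]
  congr 1
  refine Finset.prod_congr rfl fun j _ => ?_
  rw [← AddSubgroup.comap_mk_map_quotientMap, AddSubgroup.card_comap_quotient_mk, Nat.cast_mul,
    ENNReal.mul_rpow_of_ne_top (ENNReal.natCast_ne_top _) (ENNReal.natCast_ne_top _)]

/-- **Lemma (factorization for `𝔸`).** For a finite Abelian group HBL datum `𝒢`,
`s ∈ [0,1]^m` and a subgroup `G' ≤ G` with sub-datum `𝒢'` and quotient datum `𝒢/𝒢'`:
if `A(G',s) = 𝔸(𝒢',s)`, then `𝔸(𝒢/𝒢',s) · 𝔸(𝒢',s) ≤ 𝔸(𝒢,s)`. -/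
theorem HBLA_factorization {G : Type*} [AddCommGroup G] [Fintype G]
    {m : ℕ} (hm : 0 < m) {Gj : Fin m → Type*} [∀ j, AddCommGroup (Gj j)]
    [∀ j, Fintype (Gj j)] (φ : ∀ j, G →+ Gj j)
    (s : Fin m → ℝ) (hs : ∀ j, s j ∈ Set.Icc (0 : ℝ) 1)
    (G' : AddSubgroup G)
    (hcrit : HBLAloc φ s G' = HBLA (fun j => (φ j).addSubgroupMap G') s) :
    HBLA (fun j => QuotientAddGroup.map G' (G'.map (φ j)) (φ j)
        (fun _ hx => AddSubgroup.mem_map_of_mem (φ j) hx)) s *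
      HBLA (fun j => (φ j).addSubgroupMap G') s ≤ HBLA φ s := by
  rw [← hcrit]
  conv_lhs => rw [HBLA]
  simp only [ENNReal.iSup_mul]
  refine iSup₂_le fun K _ => ?_
  rw [HBLAloc_quotient_mul]
  exact le_iSup₂ (f := fun (H : AddSubgroup G) (_ : (H : Set G).Finite) => HBLAloc φ s H)
    (K.comap (QuotientAddGroup.mk' G')) (Set.toFinite _)
end
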